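/- arXiv:math/9903102 — 3 statements merged into one kernel-verified Lean document; each statement's English description precedes it below -/
import Mathlib

section
/- Let (Ω, Σ, μ) be a measure space without atoms of infinite measure and T a bounded linear operator on L¹(Ω). If for every A ∈ Σ of positive measure both ‖Id_A + T_A‖ = 1 + ‖T_A‖ and ‖Id_A − T_A‖ = 1 + ‖T_A‖ hold, then for every ε > 0 and every A ∈ Σ of positive measure there exists A' ⊆ A of positive measure such that: for every B ⊆ A' of positive measure there exists B' ⊆ B of positive measure with ‖χ_{B'}/μ(B') − χ_B/μ(B)‖ < ε and ‖χ_{B'} · T(χ_{B'}/μ(B'))‖ < ε. -/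
open MeasureTheory ENNReal

variable {Ω : Type*} [MeasurableSpace Ω]

/-- The subspace `L¹(A)` of `L¹(μ)`: functions vanishing a.e. off `A`. -/
noncomputable def LoneSub (μ : Measure Ω) (A : Set Ω) : Submodule ℝ (Lp ℝ 1 μ) where
  carrier := {f | ∀ᵐ x ∂μ, x ∉ A → f x = 0}
  zero_mem' := by
    simp only [Set.mem_setOf_eq]
    filter_upwards [Lp.coeFn_zero ℝ 1 μ] with x hx _
    simpa using hx
  add_mem' := by
    intro f g hf hg
    have : ∀ᵐ x ∂μ, x ∉ A → ((f + g : Lp ℝ 1 μ) : Ω → ℝ) x = 0 := by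
      filter_upwards [Lp.coeFn_add f g, hf, hg] with x hx h1 h2 hxA
      rw [hx]
      simp [h1 hxA, h2 hxA]
    exact this
  smul_mem' := by
    intro c f hf
    have : ∀ᵐ x ∂μ, x ∉ A → ((c • f : Lp ℝ 1 μ) : Ω → ℝ) x = 0 := by
      filter_upwards [Lp.coeFn_smul c f, hf] with x hx h1 hxA
      rw [hx]
      simp [h1 hxA]
    exact this

/-- The normalized indicator function `χ_B / μ(B)` as an element of `L¹(μ)`. -/
noncomputable def normInd (μ : Measure Ω) {B : Set Ω} (hB : MeasurableSet B)
    (hBfin : μ B ≠ ∞) : Lp ℝ 1 μ :=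
  indicatorConstLp 1 hB hBfin ((μ B).toReal)⁻¹

/-- Condition (ii) of the key Proposition for an operator `T` on `L¹(μ)`. -/
def propII (μ : Measure Ω) (T : Lp ℝ 1 μ →L[ℝ] Lp ℝ 1 μ) : Prop :=
  ∀ ε > (0 : ℝ), ∀ A : Set Ω, MeasurableSet A → 0 < μ A →
    ∃ A' ⊆ A, MeasurableSet A' ∧ 0 < μ A' ∧ μ A' ≠ ∞ ∧
      ∀ B ⊆ A', ∀ (hBm : MeasurableSet B), 0 < μ B → ∀ (hBfin : μ B ≠ ∞),
        ∃ B' ⊆ B, ∃ (hB'm : MeasurableSet B') (hB'fin : μ B' ≠ ∞), 0 < μ B' ∧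
          ‖normInd μ hB'm hB'fin - normInd μ hBm hBfin‖ < ε ∧
          ∫ x in B', |(T (normInd μ hB'm hB'fin) : Ω → ℝ) x| ∂μ < ε


/-- Restriction to a measurable set, as a function on `L¹`. -/
noncomputable def auxProjFun (μ : Measure Ω) {A : Set Ω} (hA : MeasurableSet A)
    (f : Lp ℝ 1 μ) : Lp ℝ 1 μ :=
  MemLp.toLp (A.indicator (f : Ω → ℝ)) ((Lp.memLp f).indicator hA)

theorem auxProjFun_coe (μ : Measure Ω) {A : Set Ω} (hA : MeasurableSet A) (f : Lp ℝ 1 μ) :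
    (auxProjFun μ hA f : Ω → ℝ) =ᵐ[μ] A.indicator (f : Ω → ℝ) :=
  MemLp.coeFn_toLp _

theorem auxProjFun_add (μ : Measure Ω) {A : Set Ω} (hA : MeasurableSet A) (f g : Lp ℝ 1 μ) :
    auxProjFun μ hA (f + g) = auxProjFun μ hA f + auxProjFun μ hA g := by
  apply Lp.ext
  filter_upwards [Lp.coeFn_add f g, auxProjFun_coe μ hA (f + g), auxProjFun_coe μ hA f,
    auxProjFun_coe μ hA g, Lp.coeFn_add (auxProjFun μ hA f) (auxProjFun μ hA g)]
    with x h1 h2 h3 h4 h5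
  rw [h2, h5, Pi.add_apply, h3, h4]
  by_cases hx : x ∈ A
  · simp only [Set.indicator_of_mem hx, h1, Pi.add_apply]
  · simp [hx]

theorem auxProjFun_smul (μ : Measure Ω) {A : Set Ω} (hA : MeasurableSet A) (c : ℝ)
    (f : Lp ℝ 1 μ) : auxProjFun μ hA (c • f) = c • auxProjFun μ hA f := by
  apply Lp.ext
  filter_upwards [Lp.coeFn_smul c f, auxProjFun_coe μ hA (c • f), auxProjFun_coe μ hA f,
    Lp.coeFn_smul c (auxProjFun μ hA f)] with x h1 h2 h3 h5
  rw [h2, h5, Pi.smul_apply, h3]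
  by_cases hx : x ∈ A <;> simp [hx, h1]

theorem auxProjFun_norm (μ : Measure Ω) {A : Set Ω} (hA : MeasurableSet A)
    (f : Lp ℝ 1 μ) : ‖auxProjFun μ hA f‖ ≤ 1 * ‖f‖ := by
  rw [one_mul]
  apply Lp.norm_le_norm_of_ae_le
  filter_upwards [auxProjFun_coe μ hA f] with x hx
  rw [hx]
  exact norm_indicator_le_norm_self _ _

/-- Restriction to a measurable set, as a linear map on `L¹`. -/
noncomputable def auxProjLin (μ : Measure Ω) {A : Set Ω} (hA : MeasurableSet A) :
    Lp ℝ 1 μ →ₗ[ℝ] Lp ℝ 1 μ where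
  toFun := auxProjFun μ hA
  map_add' := auxProjFun_add μ hA
  map_smul' := auxProjFun_smul μ hA

/-- Restriction to a measurable set, as an operator on `L¹`. -/
noncomputable def auxProj (μ : Measure Ω) {A : Set Ω} (hA : MeasurableSet A) :
    Lp ℝ 1 μ →L[ℝ] Lp ℝ 1 μ :=
  (auxProjLin μ hA).mkContinuous 1 (auxProjFun_norm μ hA)

theorem auxProj_coe (μ : Measure Ω) {A : Set Ω} (hA : MeasurableSet A) (f : Lp ℝ 1 μ) :
    (auxProj μ hA f : Ω → ℝ) =ᵐ[μ] A.indicator (f : Ω → ℝ) :=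
  auxProjFun_coe μ hA f

theorem aux_norm_add (μ : Measure Ω) {f g : Ω → ℝ} (hf : MemLp f 1 μ) (hg : MemLp g 1 μ)
    (hd : Disjoint (Function.support f) (Function.support g)) :
    ‖hf.toLp f + hg.toLp g‖ = ‖hf.toLp f‖ + ‖hg.toLp g‖ := by
  rw [L1.norm_eq_integral_norm, L1.norm_eq_integral_norm, L1.norm_eq_integral_norm,
    ← integral_add (L1.integrable_coeFn _).norm (L1.integrable_coeFn _).norm]
  apply integral_congr_ae
  filter_upwards [hf.coeFn_toLp, hg.coeFn_toLp, Lp.coeFn_add (hf.toLp f) (hg.toLp g)]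
    with x h1 h2 h3
  rw [h3, Pi.add_apply, h1, h2]
  by_cases hx : f x = 0
  · simp [hx]
  · have : g x = 0 := by
      by_contra h
      exact Set.disjoint_left.1 hd hx h
    simp [this]

theorem aux_norm_ind (μ : Measure Ω) {B : Set Ω} (hB : MeasurableSet B) (hf : μ B ≠ ∞) (c : ℝ) :
    ‖indicatorConstLp 1 hB hf c‖ = |c| * μ.real B := by
  rw [norm_indicatorConstLp (by simp) (by simp)]
  simp

theorem aux_ind_smul (μ : Measure Ω) {B : Set Ω} (hB : MeasurableSet B) (hf : μ B ≠ ∞) (c : ℝ) :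
    indicatorConstLp 1 hB hf c = c • (indicatorConstLp 1 hB hf (1:ℝ) : Lp ℝ 1 μ) := by
  apply Lp.ext
  filter_upwards [indicatorConstLp_coeFn (p := 1) (hs := hB) (hμs := hf) (c := c),
    indicatorConstLp_coeFn (p := 1) (hs := hB) (hμs := hf) (c := (1:ℝ)),
    Lp.coeFn_smul c (indicatorConstLp 1 hB hf (1:ℝ) : Lp ℝ 1 μ)] with x h1 h2 h3
  rw [h1, h3, Pi.smul_apply, h2]
  by_cases hx : x ∈ B <;> simp [hx]

/-- The norm of an operator on `L¹(A)` is determined by indicators. -/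
theorem aux_norm_le (μ : Measure Ω) (S : Lp ℝ 1 μ →L[ℝ] Lp ℝ 1 μ) {A : Set Ω}
    (hA : MeasurableSet A) {M : ℝ} (hM : 0 ≤ M)
    (h : ∀ B ⊆ A, ∀ (hB : MeasurableSet B) (hf : μ B ≠ ∞),
      ‖S (indicatorConstLp 1 hB hf (1:ℝ))‖ ≤ M * μ.real B) :
    ‖S.comp (LoneSub μ A).subtypeL‖ ≤ M := by
  have key : ∀ f : Lp ℝ 1 μ, ‖S (auxProj μ hA f)‖ ≤ M * ‖f‖ := by
    refine Lp.induction (by simp) (fun f : Lp ℝ 1 μ => ‖S (auxProj μ hA f)‖ ≤ M * ‖f‖) ?_ ?_ ?_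
    · intro c s hs hμs
      rw [Lp.simpleFunc.coe_indicatorConst]
      have hfin : μ (A ∩ s) ≠ ∞ := ((measure_mono Set.inter_subset_right).trans_lt hμs).ne
      have : auxProj μ hA (indicatorConstLp 1 hs hμs.ne c)
          = c • indicatorConstLp 1 (hA.inter hs) hfin (1:ℝ) := by
        rw [← aux_ind_smul]
        apply Lp.ext
        filter_upwards [auxProj_coe μ hA (indicatorConstLp 1 hs hμs.ne c),
          indicatorConstLp_coeFn (p := 1) (hs := hs) (hμs := hμs.ne) (c := c),
          indicatorConstLp_coeFn (p := 1) (hs := hA.inter hs) (hμs := hfin) (c := c)]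
          with x h1 h2 h3
        rw [h1, h3]
        by_cases hx : x ∈ A <;> by_cases hx' : x ∈ s <;> simp [hx, hx', h2]
      rw [this, map_smul, norm_smul, aux_norm_ind, Real.norm_eq_abs]
      have h1 := h _ Set.inter_subset_left (hA.inter hs) hfin
      have h2 : μ.real (A ∩ s) ≤ μ.real s := measureReal_mono Set.inter_subset_right hμs.ne
      calc |c| * ‖S (indicatorConstLp 1 (hA.inter hs) hfin (1:ℝ))‖
          ≤ |c| * (M * μ.real s) := by gcongr; exact h1.trans (by gcongr)
        _ = _ := by ring
    · intro f g hf hg hd h1 h2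
      rw [aux_norm_add μ hf hg hd, map_add, map_add, mul_add]
      exact (norm_add_le _ _).trans (add_le_add h1 h2)
    · exact isClosed_le (by fun_prop) (by fun_prop)
  refine ContinuousLinearMap.opNorm_le_bound _ hM ?_
  intro f
  have hf : auxProj μ hA (f : Lp ℝ 1 μ) = f := by
    apply Lp.ext
    have h2 : ∀ᵐ x ∂μ, x ∉ A → (f : Lp ℝ 1 μ) x = 0 := f.2
    filter_upwards [auxProj_coe μ hA (f : Lp ℝ 1 μ), h2] with x h1 h2
    rw [h1]
    by_cases hx : x ∈ A
    · simp [hx]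
    · simp [hx, h2 hx]
  have := key f
  rw [hf] at this
  exact this

/-- The operator norm bounds the values at indicators. -/
theorem aux_le_norm (μ : Measure Ω) (S : Lp ℝ 1 μ →L[ℝ] Lp ℝ 1 μ) {A B : Set Ω}
    (hBA : B ⊆ A) (hB : MeasurableSet B) (hf : μ B ≠ ∞) :
    ‖S (indicatorConstLp 1 hB hf (1:ℝ))‖ ≤ ‖S.comp (LoneSub μ A).subtypeL‖ * μ.real B := by
  have hmem : (indicatorConstLp 1 hB hf (1:ℝ) : Lp ℝ 1 μ) ∈ LoneSub μ A := by
    have : ∀ᵐ x ∂μ, x ∉ A → (indicatorConstLp 1 hB hf (1:ℝ) : Lp ℝ 1 μ) x = 0 := by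
      filter_upwards [indicatorConstLp_coeFn_notMem (p := 1) (hs := hB) (hμs := hf) (c := (1:ℝ))]
        with x hx hxA
      exact hx (fun h => hxA (hBA h))
    exact this
  have := (S.comp (LoneSub μ A).subtypeL).le_opNorm ⟨_, hmem⟩
  have h2 : ‖(⟨_, hmem⟩ : LoneSub μ A)‖ = μ.real B := by
    rw [Submodule.coe_norm, aux_norm_ind]; simp
  rw [h2] at this
  exact this

/-- Exhaustion. -/
theorem aux_exhaust (μ : Measure Ω) (P : Set Ω → Prop) {C : Set Ω} (hC : MeasurableSet C)
    (hCf : μ C ≠ ∞) (hC0 : 0 < μ C)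
    (h : ∀ A ⊆ C, MeasurableSet A → 0 < μ A → ∃ B ⊆ A, MeasurableSet B ∧ 0 < μ B ∧ P B) :
    ∃ F : Finset (Set Ω), (∀ B ∈ F, B ⊆ C ∧ MeasurableSet B ∧ 0 < μ B ∧ P B) ∧
      (F : Set (Set Ω)).PairwiseDisjoint id ∧ μ C / 2 < ∑ B ∈ F, μ B := by
  obtain ⟨S, hS⟩ := zorn_subset
    {S : Set (Set Ω) | (∀ B ∈ S, B ⊆ C ∧ MeasurableSet B ∧ 0 < μ B ∧ P B) ∧
      S.PairwiseDisjoint id} (by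
    intro c hc hchain
    refine ⟨⋃₀ c, ⟨?_, ?_⟩, fun s hs => Set.subset_sUnion_of_mem hs⟩
    · rintro B ⟨s, hs, hB⟩
      exact (hc hs).1 B hB
    · exact (Set.pairwiseDisjoint_sUnion hchain.directedOn).2 fun s hs => (hc hs).2)
  obtain ⟨⟨hSP, hSd⟩, hmax⟩ := hS
  have hdisj : Pairwise (Function.onFun Disjoint (fun B : S => (B : Set Ω))) := by
    intro a b hab
    exact hSd a.2 b.2 (fun h => hab (Subtype.ext h))
  have hsub : (⋃ B : S, (B : Set Ω)) ⊆ C := Set.iUnion_subset fun B => (hSP B B.2).1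
  have hcount : Countable S := by
    have := Measure.countable_meas_pos_of_disjoint_of_meas_iUnion_ne_top μ
      (As := fun B : S => (B : Set Ω)) (fun B => (hSP B B.2).2.1) hdisj
      ((measure_mono hsub).trans_lt hCf.lt_top).ne
    have h2 : {i : S | 0 < μ (i : Set Ω)} = Set.univ := by
      ext B; simp [(hSP B B.2).2.2.1]
    rw [h2] at this
    exact Set.countable_univ_iff.1 this
  have hUm : MeasurableSet (⋃ B : S, (B : Set Ω)) :=
    MeasurableSet.iUnion fun B => (hSP B B.2).2.1
  have hfull : μ (C \ ⋃ B : S, (B : Set Ω)) = 0 := by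
    by_contra hne
    obtain ⟨B, hBsub, hBm, hBpos, hBP⟩ := h _ Set.sdiff_subset (hC.diff hUm) (pos_iff_ne_zero.2 hne)
    have hBd : ∀ D ∈ S, Disjoint B D := by
      intro D hD
      refine Set.disjoint_left.2 fun x hx hxD => (hBsub hx).2 (Set.mem_iUnion.2 ⟨⟨D, hD⟩, hxD⟩)
    have hins : insert B S ⊆ S := by
      apply hmax ⟨?_, ?_⟩ (Set.subset_insert _ _)
      · rintro D (rfl | hD)
        · exact ⟨hBsub.trans Set.sdiff_subset, hBm, hBpos, hBP⟩
        · exact hSP D hD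
      · exact hSd.insert fun D hD _ => hBd D hD
    have := hBd B (hins (Set.mem_insert _ _))
    rw [disjoint_self] at this
    simp [this] at hBpos
  have hsum : μ C / 2 < ∑' B : S, μ (B : Set Ω) := by
    rw [← measure_iUnion hdisj (fun B => (hSP B B.2).2.1)]
    refine (ENNReal.half_lt_self hC0.ne' hCf).trans_le ?_
    calc μ C ≤ μ ((⋃ B : S, (B : Set Ω)) ∪ (C \ ⋃ B : S, (B : Set Ω))) :=
          measure_mono (by simp)
      _ ≤ _ := measure_union_le _ _
      _ = _ := by rw [hfull, add_zero]
  rw [ENNReal.tsum_eq_iSup_sum, lt_iSup_iff] at hsum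
  obtain ⟨F, hF⟩ := hsum
  refine ⟨F.map (Function.Embedding.subtype _), ?_, ?_, ?_⟩
  · intro B hB
    obtain ⟨D, -, rfl⟩ := Finset.mem_map.1 hB
    exact hSP D D.2
  · refine hSd.subset ?_
    intro B hB
    obtain ⟨D, -, rfl⟩ := Finset.mem_map.1 (Finset.mem_coe.1 hB)
    exact D.2
  · simpa using hF

open Classical in
/-- Indicator function as an element of `L¹` (zero if not meaningful). -/
noncomputable def auxInd (μ : Measure Ω) (B : Set Ω) : Lp ℝ 1 μ :=
  if h : MeasurableSet B ∧ μ B ≠ ∞ then indicatorConstLp 1 h.1 h.2 (1:ℝ) else 0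

theorem auxInd_eq (μ : Measure Ω) {B : Set Ω} (hB : MeasurableSet B) (hf : μ B ≠ ∞) :
    auxInd μ B = indicatorConstLp 1 hB hf (1:ℝ) := by
  rw [auxInd, dif_pos ⟨hB, hf⟩]

theorem auxInd_coe (μ : Measure Ω) {B : Set Ω} (hB : MeasurableSet B) (hf : μ B ≠ ∞) :
    (auxInd μ B : Ω → ℝ) =ᵐ[μ] B.indicator fun _ => 1 := by
  rw [auxInd_eq μ hB hf]; exact indicatorConstLp_coeFn

theorem aux_coe_sum (μ : Measure Ω) (F : Finset (Set Ω)) (u : Set Ω → Lp ℝ 1 μ) :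
    ((∑ B ∈ F, u B : Lp ℝ 1 μ) : Ω → ℝ) =ᵐ[μ] fun x => ∑ B ∈ F, (u B : Ω → ℝ) x := by
  classical
  induction F using Finset.induction_on with
  | empty => simp only [Finset.sum_empty]; exact Lp.coeFn_zero ℝ 1 μ
  | insert a F ha ih =>
    rw [Finset.sum_insert ha]
    filter_upwards [ih, Lp.coeFn_add (u a) (∑ B ∈ F, u B)] with x h1 h2
    rw [h2, Pi.add_apply, h1, Finset.sum_insert ha]

theorem auxInd_split (μ : Measure Ω) {a R : Set Ω} (ha : MeasurableSet a) (hR : MeasurableSet R)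
    (hRf : μ R ≠ ∞) (haR : a ⊆ R) : auxInd μ R = auxInd μ a + auxInd μ (R \ a) := by
  apply Lp.ext
  filter_upwards [auxInd_coe μ hR hRf,
    auxInd_coe μ ha ((measure_mono haR).trans_lt hRf.lt_top).ne,
    auxInd_coe μ (hR.diff ha) ((measure_mono Set.sdiff_subset).trans_lt hRf.lt_top).ne,
    Lp.coeFn_add (auxInd μ a) (auxInd μ (R \ a))] with x h1 h2 h3 h4
  rw [h4, Pi.add_apply, h1, h2, h3]
  by_cases hx : x ∈ a
  · simp [hx, haR hx]
  · by_cases hx' : x ∈ R <;> simp [hx, hx']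

theorem aux_decomp (μ : Measure Ω) {C : Set Ω} (hC : MeasurableSet C) (hCf : μ C ≠ ∞)
    (F : Finset (Set Ω)) (hF : ∀ B ∈ F, B ⊆ C ∧ MeasurableSet B)
    (hd : (F : Set (Set Ω)).PairwiseDisjoint id) :
    ∃ R ⊆ C, MeasurableSet R ∧ auxInd μ C = ∑ B ∈ F, auxInd μ B + auxInd μ R ∧
      μ.real C = ∑ B ∈ F, μ.real B + μ.real R := by
  classical
  suffices h : ∃ R ⊆ C, (∀ x ∈ C, (∀ B ∈ F, x ∉ B) → x ∈ R) ∧ MeasurableSet R ∧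
      auxInd μ C = ∑ B ∈ F, auxInd μ B + auxInd μ R ∧
      μ.real C = ∑ B ∈ F, μ.real B + μ.real R by
    obtain ⟨R, h1, -, h2⟩ := h
    exact ⟨R, h1, h2⟩
  induction F using Finset.induction_on with
  | empty => exact ⟨C, subset_rfl, fun x hx _ => hx, hC, by simp, by simp⟩
  | insert a F ha ih =>
    obtain ⟨R, hRC, hx, hRm, h1, h2⟩ := ih (fun B hB => hF B (Finset.mem_insert_of_mem hB))
      (hd.subset (by simp))
    obtain ⟨haC, ham⟩ := hF a (Finset.mem_insert_self _ _)
    have hRf : μ R ≠ ∞ := ((measure_mono hRC).trans_lt hCf.lt_top).ne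
    have haR : a ⊆ R := by
      intro x hxa
      refine hx x (haC hxa) fun B hB hxB => ?_
      have hne : a ≠ B := fun h => ha (h ▸ hB)
      have := hd (by simp) (by simp [hB]) hne
      exact Set.disjoint_left.1 this hxa hxB
    refine ⟨R \ a, Set.sdiff_subset.trans hRC, ?_, hRm.diff ham, ?_, ?_⟩
    · intro x hxC hxB
      exact ⟨hx x hxC fun B hB => hxB B (Finset.mem_insert_of_mem hB),
        hxB a (Finset.mem_insert_self _ _)⟩
    · rw [h1, Finset.sum_insert ha, auxInd_split μ ham hRm hRf haR]
      abel
    · have : μ.real (R \ a) = μ.real R - μ.real a :=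
        measureReal_sdiff haR ham hRf
      rw [h2, Finset.sum_insert ha, this]
      ring

/-- One-sided version. -/
theorem aux_main (μ : Measure Ω) (T : Lp ℝ 1 μ →L[ℝ] Lp ℝ 1 μ)
    (hD : ∀ A : Set Ω, MeasurableSet A → 0 < μ A →
      ‖(LoneSub μ A).subtypeL + T.comp (LoneSub μ A).subtypeL‖
          = 1 + ‖T.comp (LoneSub μ A).subtypeL‖)
    {ε : ℝ} (hε : 0 < ε) {A : Set Ω} (hA : MeasurableSet A) (hA0 : 0 < μ A) (hAf : μ A ≠ ∞) :
    ∃ A' ⊆ A, MeasurableSet A' ∧ 0 < μ A' ∧ ∀ B ⊆ A', MeasurableSet B → 0 < μ B →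
      ∫ x in B, (|(T (auxInd μ B) : Ω → ℝ) x| - (T (auxInd μ B) : Ω → ℝ) x) ∂μ
        ≤ ε * μ.real B := by
  by_contra hcon
  push Not at hcon
  obtain ⟨η, hη0, hη1, hηε⟩ : ∃ η : ℝ, 0 < η ∧ η ≤ 1 ∧ 12 * η ≤ ε :=
    ⟨min 1 (ε / 12), by positivity, min_le_left _ _, by
      have := min_le_right 1 (ε / 12); linarith⟩
  set t := ‖T.comp (LoneSub μ A).subtypeL‖ with ht
  have ht0 : 0 ≤ t := by rw [ht]; exact norm_nonneg (T.comp (LoneSub μ A).subtypeL)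
  have hT : ∀ B ⊆ A, MeasurableSet B → ‖T (auxInd μ B)‖ ≤ t * μ.real B := by
    intro B hB hBm
    have hf : μ B ≠ ∞ := ((measure_mono hB).trans_lt hAf.lt_top).ne
    rw [auxInd_eq μ hBm hf]
    exact aux_le_norm μ T hB hBm hf
  -- the good set
  obtain ⟨C, hCA, hC, hCf, hCgood⟩ : ∃ C ⊆ A, MeasurableSet C ∧ μ C ≠ ∞ ∧
      (1 + t - η ^ 2) * μ.real C < ‖auxInd μ C + T (auxInd μ C)‖ := by
    by_contra hno
    push Not at hno
    have := aux_norm_le μ (ContinuousLinearMap.id ℝ _ + T) hA (M := 1 + t - η ^ 2)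
      (by nlinarith) (by
        intro B hB hBm hf
        have := hno B hB hBm hf
        rw [auxInd_eq μ hBm hf] at this
        exact this)
    have h2 := hD A hA hA0
    have h3 : (ContinuousLinearMap.id ℝ (Lp ℝ 1 μ) + T).comp (LoneSub μ A).subtypeL
        = (LoneSub μ A).subtypeL + T.comp (LoneSub μ A).subtypeL := by
      ext1 x; rfl
    rw [h3, h2] at this
    have : 0 < η ^ 2 := by positivity
    linarith
  set m := μ.real C with hm
  set g := T (auxInd μ C) with hg
  have hnC : ‖auxInd μ C‖ = m := by
    rw [auxInd_eq μ hC hCf, aux_norm_ind]; simp [hm]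
  have hm0 : 0 < m := by
    have h0 : 0 ≤ m := measureReal_nonneg
    rcases h0.lt_or_eq with h | h
    · exact h
    · exfalso
      have hz : auxInd μ C = 0 := by rw [← norm_eq_zero, hnC, ← h]
      rw [hg, hz] at hCgood
      simp [← h] at hCgood
  have hgm : ‖g‖ ≤ t * m := hT C hCA hC
  have hglow : (t - η ^ 2) * m < ‖g‖ := by
    have := norm_add_le (auxInd μ C) g
    rw [hnC] at this
    linarith
  have hgmeas : Measurable (g : Ω → ℝ) := (Lp.stronglyMeasurable g).measurable
  set D : Set Ω := C ∩ {x | (g : Ω → ℝ) x < -η} with hDdef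
  have hDm : MeasurableSet D := hC.inter (measurableSet_lt hgmeas measurable_const)
  have hDC : D ⊆ C := Set.inter_subset_left
  have hDf : μ D ≠ ∞ := ((measure_mono hDC).trans_lt hCf.lt_top).ne
  have hint : ∀ f : Lp ℝ 1 μ, Integrable (fun x => |(f : Ω → ℝ) x|) μ :=
    fun f => (L1.integrable_coeFn f).norm
  have hnorm : ∀ f : Lp ℝ 1 μ, ‖f‖ = ∫ x, |(f : Ω → ℝ) x| ∂μ :=
    fun f => L1.norm_eq_integral_norm f
  have hindint : ∀ (E : Set Ω) (c : ℝ), MeasurableSet E → μ E ≠ ∞ →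
      Integrable (E.indicator fun _ => c) μ := by
    intro E c hE hEf
    exact (integrable_indicator_iff hE).2 (integrableOn_const hEf)
  have hindval : ∀ (E : Set Ω) (c : ℝ), MeasurableSet E →
      ∫ x, E.indicator (fun _ => c) x ∂μ = μ.real E * c := by
    intro E c hE
    rw [integral_indicator_const _ hE, smul_eq_mul]
  have hDsmall : 2 * η * μ.real D < η ^ 2 * m := by
    have h1 : ‖auxInd μ C + g‖ ≤ ‖auxInd μ C‖ + ‖g‖ - μ.real D * (2 * η) := by
      have hi1 : Integrable (fun x => |(auxInd μ C : Ω → ℝ) x| + |(g : Ω → ℝ) x|) μ :=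
        (hint _).add (hint _)
      rw [hnorm, hnorm (auxInd μ C), hnorm g, ← hindval D _ hDm,
        ← integral_add (hint _) (hint _),
        ← integral_sub hi1 (hindint D _ hDm hDf)]
      apply integral_mono_ae (hint _) (hi1.sub (hindint D _ hDm hDf))
      filter_upwards [Lp.coeFn_add (auxInd μ C) g, auxInd_coe μ hC hCf] with x h1 h2
      simp only [h1, Pi.add_apply, Pi.sub_apply, h2]
      by_cases hx : x ∈ D
      · have hx1 : x ∈ C := hx.1
        have hx2 : (g : Ω → ℝ) x < -η := hx.2
        simp only [Set.indicator_of_mem hx, Set.indicator_of_mem hx1]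
        rw [abs_of_neg (by linarith : (g : Ω → ℝ) x < 0), abs_one]
        apply abs_le.2; constructor <;> linarith
      · simp only [Set.indicator_of_notMem hx, sub_zero]
        exact abs_add_le _ _
    rw [hnC] at h1
    linarith
  set C0 : Set Ω := C \ D with hC0def
  have hC0m : MeasurableSet C0 := hC.diff hDm
  have hC0C : C0 ⊆ C := Set.sdiff_subset
  have hC0f : μ C0 ≠ ∞ := ((measure_mono hC0C).trans_lt hCf.lt_top).ne
  have hC0r : m / 2 ≤ μ.real C0 := by
    have h1 : μ.real C0 = m - μ.real D := measureReal_sdiff hDC hDm hCf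
    have h2 : μ.real D < η / 2 * m := by
      have : η * (2 * μ.real D) < η * (η * m) := by linarith
      have := lt_of_mul_lt_mul_left this hη0.le
      linarith
    have h3 : η * m ≤ m := by nlinarith
    linarith
  have hC0pos : 0 < μ C0 := by
    have : 0 < μ.real C0 := by linarith
    exact (ENNReal.toReal_pos_iff.1 this).1
  obtain ⟨F, hF, hFd, hFs⟩ := aux_exhaust μ
    (fun B => ε * μ.real B
      < ∫ x in B, (|(T (auxInd μ B) : Ω → ℝ) x| - (T (auxInd μ B) : Ω → ℝ) x) ∂μ)
    hC0m hC0f hC0pos (by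
      intro A1 hA1 hA1m hA1p
      obtain ⟨B, h1, h2, h3, h4⟩ := hcon A1 (hA1.trans (hC0C.trans hCA)) hA1m hA1p
      exact ⟨B, h1, h2, h3, h4⟩)
  have hFfin : ∀ B ∈ F, μ B ≠ ∞ := fun B hB =>
    ((measure_mono (hF B hB).1).trans_lt hC0f.lt_top).ne
  have hFs' : m / 4 < ∑ B ∈ F, μ.real B := by
    have h1 := (ENNReal.toReal_lt_toReal (by finiteness)
      (ENNReal.sum_ne_top.2 hFfin)).2 hFs
    rw [ENNReal.toReal_sum hFfin, ENNReal.toReal_div] at h1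
    have h2 : μ.real C0 / 2 < ∑ B ∈ F, μ.real B := h1
    linarith
  obtain ⟨R, hRC, hRm, hdec, hmdec⟩ := aux_decomp μ hC hCf F
    (fun B hB => ⟨(hF B hB).1.trans hC0C, (hF B hB).2.1⟩) hFd
  have hgdec : g = ∑ B ∈ F, T (auxInd μ B) + T (auxInd μ R) := by
    rw [hg, hdec, map_add, map_sum]
  have hae : ∀ᵐ x ∂μ, (g : Ω → ℝ) x
      = ∑ B ∈ F, (T (auxInd μ B) : Ω → ℝ) x + (T (auxInd μ R) : Ω → ℝ) x := by
    rw [hgdec]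
    filter_upwards [Lp.coeFn_add (∑ B ∈ F, T (auxInd μ B)) (T (auxInd μ R)),
      aux_coe_sum μ F (fun B => T (auxInd μ B))] with x h1 h2
    rw [h1, Pi.add_apply, h2]
  have hlow : ε * (m / 4) < ∑ B ∈ F,
      ∫ x in B, (|(T (auxInd μ B) : Ω → ℝ) x| - (T (auxInd μ B) : Ω → ℝ) x) ∂μ := by
    calc ε * (m / 4) < ε * ∑ B ∈ F, μ.real B := by gcongr
      _ = ∑ B ∈ F, ε * μ.real B := Finset.mul_sum _ _ _
      _ ≤ _ := Finset.sum_le_sum fun B hB => (hF B hB).2.2.2.le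
  have hupp : ∑ B ∈ F,
      ∫ x in B, (|(T (auxInd μ B) : Ω → ℝ) x| - (T (auxInd μ B) : Ω → ℝ) x) ∂μ
      ≤ ∑ B ∈ F, ‖T (auxInd μ B)‖ + ‖T (auxInd μ R)‖ - ‖g‖ + μ.real C0 * (2 * η) := by
    have hi : ∀ B : Set Ω, Integrable
        (fun x => |(T (auxInd μ B) : Ω → ℝ) x| - (T (auxInd μ B) : Ω → ℝ) x) μ :=
      fun B => (hint _).sub (L1.integrable_coeFn _)
    have hL : ∑ B ∈ F,
        ∫ x in B, (|(T (auxInd μ B) : Ω → ℝ) x| - (T (auxInd μ B) : Ω → ℝ) x) ∂μ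
        = ∫ x, ∑ B ∈ F, B.indicator
          (fun x => |(T (auxInd μ B) : Ω → ℝ) x| - (T (auxInd μ B) : Ω → ℝ) x) x ∂μ := by
      rw [integral_finsetSum _ (fun B hB => (hi B).indicator (hF B hB).2.1)]
      exact Finset.sum_congr rfl fun B hB => (integral_indicator (hF B hB).2.1).symm
    have hsumint : Integrable (fun x => ∑ B ∈ F, |(T (auxInd μ B) : Ω → ℝ) x|) μ :=
      integrable_finsetSum _ fun B _ => hint _
    have hi1 : Integrable (fun x => ∑ B ∈ F, |(T (auxInd μ B) : Ω → ℝ) x|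
        + |(T (auxInd μ R) : Ω → ℝ) x|) μ := hsumint.add (hint _)
    have hi2 : Integrable (fun x => ∑ B ∈ F, |(T (auxInd μ B) : Ω → ℝ) x|
        + |(T (auxInd μ R) : Ω → ℝ) x| - |(g : Ω → ℝ) x|) μ := hi1.sub (hint _)
    have hR : ∑ B ∈ F, ‖T (auxInd μ B)‖ + ‖T (auxInd μ R)‖ - ‖g‖ + μ.real C0 * (2 * η)
        = ∫ x, (∑ B ∈ F, |(T (auxInd μ B) : Ω → ℝ) x| + |(T (auxInd μ R) : Ω → ℝ) x|
          - |(g : Ω → ℝ) x| + C0.indicator (fun _ => 2 * η) x) ∂μ := by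
      rw [integral_add hi2 (hindint _ _ hC0m hC0f),
        integral_sub hi1 (hint _), integral_add hsumint (hint _),
        integral_finsetSum _ (fun B _ => hint _), hindval _ _ hC0m, hnorm g,
        hnorm (T (auxInd μ R))]
      simp only [hnorm]
    rw [hL, hR]
    apply integral_mono_ae
      (integrable_finsetSum _ (fun B hB => (hi B).indicator (hF B hB).2.1))
      (hi2.add (hindint _ _ hC0m hC0f))
    filter_upwards [hae] with x hx
    by_cases hxC : x ∈ C0
    · have hgx : -η ≤ (g : Ω → ℝ) x := by
        by_contra hlt
        exact hxC.2 ⟨hxC.1, not_le.1 hlt⟩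
      have h1 : |(g : Ω → ℝ) x| ≤ (g : Ω → ℝ) x + 2 * η := by
        apply abs_le.2; constructor <;> linarith
      have h2 : ∑ B ∈ F, B.indicator
          (fun x => |(T (auxInd μ B) : Ω → ℝ) x| - (T (auxInd μ B) : Ω → ℝ) x) x
          ≤ ∑ B ∈ F, (|(T (auxInd μ B) : Ω → ℝ) x| - (T (auxInd μ B) : Ω → ℝ) x) := by
        apply Finset.sum_le_sum
        intro B _
        apply Set.indicator_le_self' (f := fun x => |(T (auxInd μ B) : Ω → ℝ) x|
          - (T (auxInd μ B) : Ω → ℝ) x)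
        intro x _
        exact sub_nonneg.2 (le_abs_self _)
      rw [Finset.sum_sub_distrib] at h2
      have h3 := le_abs_self ((T (auxInd μ R) : Ω → ℝ) x)
      have h4 : C0.indicator (fun _ => 2 * η) x = 2 * η := Set.indicator_of_mem hxC _
      rw [Pi.add_apply, h4]
      linarith
    · have h2 : ∑ B ∈ F, B.indicator
          (fun x => |(T (auxInd μ B) : Ω → ℝ) x| - (T (auxInd μ B) : Ω → ℝ) x) x = 0 := by
        apply Finset.sum_eq_zero
        intro B hB
        exact Set.indicator_of_notMem (fun h => hxC ((hF B hB).1 h)) _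
      have h3 : |(g : Ω → ℝ) x| ≤ ∑ B ∈ F, |(T (auxInd μ B) : Ω → ℝ) x|
          + |(T (auxInd μ R) : Ω → ℝ) x| := by
        rw [hx]
        refine (abs_add_le _ _).trans ?_
        gcongr
        exact Finset.abs_sum_le_sum_abs _ _
      have h4 : C0.indicator (fun _ => 2 * η) x = 0 := Set.indicator_of_notMem hxC _
      rw [Pi.add_apply, h4]
      linarith
  have hs1 : ∑ B ∈ F, ‖T (auxInd μ B)‖ ≤ t * ∑ B ∈ F, μ.real B := by
    rw [Finset.mul_sum]
    exact Finset.sum_le_sum fun B hB => hT B ((hF B hB).1.trans (hC0C.trans hCA)) (hF B hB).2.1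
  have hs2 := hT R (hRC.trans hCA) hRm
  have hs3 : μ.real C0 ≤ m := measureReal_mono hC0C hCf
  have hs4 : t * m = t * ∑ B ∈ F, μ.real B + t * μ.real R := by
    rw [hm, hmdec]; ring
  have hs5 : μ.real C0 * (2 * η) ≤ m * (2 * η) := by gcongr
  have hs6 : η ^ 2 * m ≤ η * m := by
    have : η ^ 2 ≤ η := by nlinarith
    gcongr
  have hs7 : 12 * η * m ≤ ε * m := by gcongr
  nlinarith

/-- If both `T` and `-T` satisfy the Daugavet equation on every `L¹(A)`, then
`T` satisfies condition (ii). -/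
theorem stmt4 (μ : Measure Ω) (hsemi : ∀ A : Set Ω, MeasurableSet A → μ A = ∞ →
      ∃ B ⊆ A, MeasurableSet B ∧ 0 < μ B ∧ μ B < ∞)
    (T : Lp ℝ 1 μ →L[ℝ] Lp ℝ 1 μ)
    (hDaug : ∀ A : Set Ω, MeasurableSet A → 0 < μ A →
      ‖(LoneSub μ A).subtypeL + T.comp (LoneSub μ A).subtypeL‖
          = 1 + ‖T.comp (LoneSub μ A).subtypeL‖ ∧
        ‖(LoneSub μ A).subtypeL - T.comp (LoneSub μ A).subtypeL‖
          = 1 + ‖T.comp (LoneSub μ A).subtypeL‖) :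
    propII μ T := by
  intro ε hε A hA hA0
  obtain ⟨A₀, hA₀A, hA₀m, hA₀p, hA₀f⟩ : ∃ A₀ ⊆ A, MeasurableSet A₀ ∧ 0 < μ A₀ ∧ μ A₀ < ∞ := by
    by_cases h : μ A = ∞
    · exact hsemi A hA h
    · exact ⟨A, subset_rfl, hA, hA0, lt_top_iff_ne_top.2 h⟩
  obtain ⟨A₁, hA₁A, hA₁m, hA₁p, hA₁⟩ := aux_main μ T (fun A hA h => (hDaug A hA h).1)
    (half_pos hε) hA₀m hA₀p hA₀f.ne
  have hA₁f : μ A₁ ≠ ∞ := ((measure_mono hA₁A).trans_lt hA₀f).ne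
  obtain ⟨A₂, hA₂A, hA₂m, hA₂p, hA₂⟩ := aux_main μ (-T) (fun A hA h => by
      rw [ContinuousLinearMap.neg_comp, ← sub_eq_add_neg,
        norm_neg (T.comp (LoneSub μ A).subtypeL)]
      exact (hDaug A hA h).2)
    (half_pos hε) hA₁m hA₁p hA₁f
  refine ⟨A₂, hA₂A.trans (hA₁A.trans hA₀A), hA₂m, hA₂p,
    ((measure_mono hA₂A).trans_lt hA₁f.lt_top).ne, ?_⟩
  intro B hB hBm hBp hBfin
  refine ⟨B, subset_rfl, hBm, hBfin, hBp, by simpa using hε, ?_⟩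
  have hbpos : 0 < μ.real B := ENNReal.toReal_pos hBp.ne' hBfin
  have h1 := hA₁ B (hB.trans hA₂A) hBm hBp
  have h2 := hA₂ B hB hBm hBp
  have hi := (L1.integrable_coeFn (T (auxInd μ B))).integrableOn (s := B)
  have hi' : IntegrableOn (fun x => |(T (auxInd μ B) : Ω → ℝ) x|) B μ := hi.norm
  have h3 : ∫ x in B, (|((-T) (auxInd μ B) : Ω → ℝ) x| - ((-T) (auxInd μ B) : Ω → ℝ) x) ∂μ
      = ∫ x in B, (|(T (auxInd μ B) : Ω → ℝ) x| + (T (auxInd μ B) : Ω → ℝ) x) ∂μ := by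
    apply integral_congr_ae
    apply ae_restrict_of_ae
    filter_upwards [Lp.coeFn_neg (T (auxInd μ B))] with x hx
    rw [neg_apply, hx, Pi.neg_apply, abs_neg, sub_neg_eq_add]
  rw [h3, integral_add hi' hi] at h2
  rw [integral_sub hi' hi] at h1
  have h4 : T (normInd μ hBm hBfin) = (μ.real B)⁻¹ • T (auxInd μ B) := by
    rw [normInd, aux_ind_smul, map_smul, auxInd_eq μ hBm hBfin]
    rfl
  have h5 : ∫ x in B, |(T (normInd μ hBm hBfin) : Ω → ℝ) x| ∂μ
      = (μ.real B)⁻¹ * ∫ x in B, |(T (auxInd μ B) : Ω → ℝ) x| ∂μ := by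
    rw [← integral_const_mul, h4]
    apply integral_congr_ae
    apply ae_restrict_of_ae
    filter_upwards [Lp.coeFn_smul (μ.real B)⁻¹ (T (auxInd μ B))] with x hx
    rw [hx, Pi.smul_apply, smul_eq_mul, abs_mul, abs_of_pos (inv_pos.2 hbpos)]
  rw [h5, inv_mul_lt_iff₀ hbpos]
  have : 0 < ε * μ.real B := by positivity
  linarith
end

section
/- Let (Ω, Σ, μ) be a measure space without atoms of infinite measure. The set M of bounded linear operators T on L¹(Ω) satisfying: for every ε > 0 and every A ∈ Σ of positive measure there is B ⊆ A with 0 < μ(B) < ∞ and ‖χ_B · T(χ_B/μ(B))‖ < ε, is a closed linear subspace of the bounded operators on L¹(Ω), and every T ∈ M satisfies the Daugavet equation ‖Id_A + T_A‖ = 1 + ‖T_A‖ for every A ∈ Σ of positive measure. -/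
open MeasureTheory ENNReal

variable {Ω : Type*} [MeasurableSpace Ω]

/-- The class `M`: operators shifting sufficiently many normalized indicators
off their supports. -/
def Mclass (μ : Measure Ω) : Set (Lp ℝ 1 μ →L[ℝ] Lp ℝ 1 μ) :=
  {T | ∀ ε > (0 : ℝ), ∀ A : Set Ω, MeasurableSet A → 0 < μ A →
    ∃ B ⊆ A, ∃ (hBm : MeasurableSet B) (hBfin : μ B ≠ ∞), 0 < μ B ∧
      ∫ x in B, |(T (normInd μ hBm hBfin) : Ω → ℝ) x| ∂μ < ε}


/-- local L1 norm -/
noncomputable def nrm (μ : Measure Ω) (S : Set Ω) (f : Lp ℝ 1 μ) : ℝ := ∫ x in S, |f x| ∂μ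

open Classical in
/-- indicator -/
noncomputable def ee (μ : Measure Ω) (C : Set Ω) : Lp ℝ 1 μ :=
  if h : MeasurableSet C ∧ μ C ≠ ∞ then indicatorConstLp 1 h.1 h.2 1 else 0

theorem intg (μ : Measure Ω) (f : Lp ℝ 1 μ) : Integrable (fun x => |f x|) μ :=
  (L1.integrable_coeFn f).abs

theorem nrm_nonneg (μ : Measure Ω) (S : Set Ω) (f : Lp ℝ 1 μ) : 0 ≤ nrm μ S f :=
  integral_nonneg (fun _ => abs_nonneg _)

theorem norm_eq (μ : Measure Ω) (f : Lp ℝ 1 μ) : ‖f‖ = ∫ x, |f x| ∂μ := by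
  rw [L1.norm_eq_integral_norm]; rfl

theorem nrm_univ (μ : Measure Ω) (f : Lp ℝ 1 μ) : nrm μ Set.univ f = ‖f‖ := by
  rw [norm_eq, nrm, setIntegral_univ]

theorem nrm_mono (μ : Measure Ω) {S S' : Set Ω} (h : S ⊆ S') (f : Lp ℝ 1 μ) :
    nrm μ S f ≤ nrm μ S' f :=
  setIntegral_mono_set (intg μ f).integrableOn (ae_of_all _ fun _ => abs_nonneg _)
    (LE.le.eventuallyLE h)

theorem nrm_le (μ : Measure Ω) (S : Set Ω) (f : Lp ℝ 1 μ) : nrm μ S f ≤ ‖f‖ := by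
  rw [← nrm_univ]; exact nrm_mono μ (Set.subset_univ _) f

theorem nrm_add_le (μ : Measure Ω) (S : Set Ω) (f g : Lp ℝ 1 μ) :
    nrm μ S (f + g) ≤ nrm μ S f + nrm μ S g := by
  unfold nrm
  rw [← integral_add (intg μ f).integrableOn (intg μ g).integrableOn]
  refine setIntegral_mono_ae (intg μ _).integrableOn
    ((intg μ f).add (intg μ g)).integrableOn ?_
  filter_upwards [Lp.coeFn_add f g] with x hx
  rw [hx]; exact abs_add_le _ _

theorem nrm_smul (μ : Measure Ω) (S : Set Ω) (c : ℝ) (f : Lp ℝ 1 μ) :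
    nrm μ S (c • f) = |c| * nrm μ S f := by
  unfold nrm
  rw [← integral_const_mul]
  refine integral_congr_ae (ae_restrict_of_ae ?_)
  filter_upwards [Lp.coeFn_smul c f] with x hx
  rw [hx]; simp [abs_mul]

theorem nrm_diff (μ : Measure Ω) {S B : Set Ω} (hS : MeasurableSet S) (h : S ⊆ B)
    (f : Lp ℝ 1 μ) : nrm μ B f = nrm μ S f + nrm μ (B \ S) f := by
  unfold nrm
  rw [← integral_inter_add_sdiff hS (intg μ f).integrableOn, Set.inter_eq_right.2 h]

theorem nrm_sum_le (μ : Measure Ω) (S : Set Ω) {ι : Type*} (s : Finset ι) (f : ι → Lp ℝ 1 μ) :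
    nrm μ S (∑ i ∈ s, f i) ≤ ∑ i ∈ s, nrm μ S (f i) := by
  classical
  induction s using Finset.induction_on with
  | empty => 
    have := nrm_smul μ S 0 0
    simp at this; simp [this]
  | insert a s ha ih =>
    rw [Finset.sum_insert ha, Finset.sum_insert ha]
    exact (nrm_add_le _ _ _ _).trans (by gcongr)

theorem ee_def (μ : Measure Ω) {C : Set Ω} (h : MeasurableSet C) (h' : μ C ≠ ∞) :
    ee μ C = indicatorConstLp 1 h h' 1 := by
  rw [ee, dif_pos ⟨h, h'⟩]

theorem norm_ee (μ : Measure Ω) {C : Set Ω} (h : MeasurableSet C) (h' : μ C ≠ ∞) :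
    ‖ee μ C‖ = μ.real C := by
  rw [ee_def μ h h', norm_indicatorConstLp (by simp) (by simp)]; simp

theorem ee_union (μ : Measure Ω) {C D : Set Ω} (h : MeasurableSet C) (h' : μ C ≠ ∞)
    (k : MeasurableSet D) (k' : μ D ≠ ∞) (hd : Disjoint C D) :
    ee μ (C ∪ D) = ee μ C + ee μ D := by
  rw [ee_def μ h h', ee_def μ k k', ee_def μ (h.union k) (measure_union_ne_top h' k'),
    indicatorConstLp_disjoint_union h k h' k' hd]

theorem ee_biUnion (μ : Measure Ω) {ι : Type*} (s : Finset ι) (C : ι → Set Ω)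
    (h : ∀ i, MeasurableSet (C i)) (h' : ∀ i, μ (C i) ≠ ∞)
    (hd : Pairwise (Function.onFun Disjoint C)) :
    ee μ (⋃ i ∈ s, C i) = ∑ i ∈ s, ee μ (C i) := by
  classical
  induction s using Finset.induction_on with
  | empty => 
    simp [ee]
  | insert a s ha ih =>
    rw [Finset.sum_insert ha, ← ih, Finset.set_biUnion_insert, ee_union μ (h a) (h' a)]
    · exact Finset.measurableSet_biUnion _ fun i _ => h i
    · exact (measure_biUnion_lt_top s.finite_toSet fun i _ => (h' i).lt_top).ne
    · rw [Set.disjoint_iUnion₂_right]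
      intro i hi
      exact hd (by rintro rfl; exact ha hi)

theorem indConst_eq (μ : Measure Ω) {C : Set Ω} (h : MeasurableSet C) (h' : μ C ≠ ∞) (c : ℝ) :
    indicatorConstLp 1 h h' c = c • ee μ C := by
  rw [ee_def μ h h']
  ext1
  filter_upwards [indicatorConstLp_coeFn (p := 1) (hs := h) (hμs := h') (c := c),
    indicatorConstLp_coeFn (p := 1) (hs := h) (hμs := h') (c := (1 : ℝ)),
    Lp.coeFn_smul c (indicatorConstLp 1 h h' (1 : ℝ))] with x h1 h2 h3
  rw [h1, h3, Pi.smul_apply, h2]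
  by_cases hx : x ∈ C <;> simp [hx]

theorem normInd_eq (μ : Measure Ω) {C : Set Ω} (h : MeasurableSet C) (h' : μ C ≠ ∞) :
    normInd μ h h' = (μ.real C)⁻¹ • ee μ C := by
  rw [normInd, indConst_eq]
  simp [Measure.real]

theorem mem_M_iff (μ : Measure Ω) (T : Lp ℝ 1 μ →L[ℝ] Lp ℝ 1 μ) :
    T ∈ Mclass μ ↔ ∀ ε > (0 : ℝ), ∀ A : Set Ω, MeasurableSet A → 0 < μ A →
    ∃ B ⊆ A, MeasurableSet B ∧ μ B ≠ ∞ ∧ 0 < μ B ∧ nrm μ B (T (ee μ B)) < ε * μ.real B := by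
  unfold Mclass
  rw [Set.mem_ofPred_eq]
  refine forall₂_congr fun ε _ => forall₃_congr fun A _ _ => exists_congr fun B =>
    and_congr_right fun _ => ?_
  rw [exists_prop_congr (q' := fun hB => μ B ≠ ∞ ∧ 0 < μ B ∧ nrm μ B (T (ee μ B)) < ε * μ.real B) _ Iff.rfl]
  · exact exists_prop
  intro hB
  rw [exists_prop_congr (q' := fun _ => 0 < μ B ∧ nrm μ B (T (ee μ B)) < ε * μ.real B) _ Iff.rfl]
  · exact exists_prop
  intro hB'
  refine and_congr_right fun h0 => ?_
  have hp : 0 < μ.real B := ENNReal.toReal_pos h0.ne' hB'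
  change nrm μ B _ < ε ↔ _
  rw [normInd_eq, map_smul, nrm_smul, abs_of_pos (inv_pos.2 hp), inv_mul_lt_iff₀ hp, mul_comm]

theorem exhaust (μ : Measure Ω) (B : Set Ω) (hB : MeasurableSet B) (hBf : μ B ≠ ∞)
    (P : Set Ω → Prop)
    (hP : ∀ A ⊆ B, MeasurableSet A → 0 < μ A → ∃ C ⊆ A, MeasurableSet C ∧ 0 < μ C ∧ P C)
    (η : ℝ) (hη : 0 < η) :
    ∃ (n : ℕ) (C : Fin n → Set Ω), (∀ i, C i ⊆ B) ∧ (∀ i, MeasurableSet (C i)) ∧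
      (∀ i, 0 < μ (C i)) ∧ (∀ i, P (C i)) ∧ Pairwise (Function.onFun Disjoint C) ∧
      μ.real (B \ ⋃ i, C i) < η := by
  have hz : ∃ F : Set (Set Ω), Maximal (fun F => F ∈ {F : Set (Set Ω) | (∀ C ∈ F, C ⊆ B ∧ MeasurableSet C ∧
      0 < μ C ∧ P C) ∧ F.PairwiseDisjoint id}) F := by
    apply zorn_subset
    intro c hc hch
    refine ⟨⋃₀ c, ⟨?_, ?_⟩, fun s hs => Set.subset_sUnion_of_mem hs⟩
    · rintro C ⟨F, hF, hCF⟩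
      exact (hc hF).1 C hCF
    · exact (Set.pairwiseDisjoint_sUnion hch.directedOn).2 fun F hF => (hc hF).2
  obtain ⟨F, ⟨hF1, hF2⟩, hmax⟩ := hz
  have hdis : Pairwise (Function.onFun Disjoint (fun C : F => (C : Set Ω))) := by
    intro C D hCD
    exact hF2 C.2 D.2 (fun h => hCD (Subtype.ext h))
  have hcount : Countable F := by
    have := Measure.countable_meas_pos_of_disjoint_of_meas_iUnion_ne_top μ
      (As := fun C : F => (C : Set Ω)) (fun C => (hF1 C C.2).2.1) hdis
      (ne_top_of_le_ne_top hBf (measure_mono (Set.iUnion_subset fun C => (hF1 C C.2).1)))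
    rw [Set.eq_univ_of_forall (s := {i : F | 0 < μ (i : Set Ω)}) (fun C => (hF1 C C.2).2.2.1)] at this
    exact Set.countable_univ_iff.1 this
  have hUm : MeasurableSet (⋃ C : F, (C : Set Ω)) := MeasurableSet.iUnion fun C => (hF1 C C.2).2.1
  have hUB : (⋃ C : F, (C : Set Ω)) ⊆ B := Set.iUnion_subset fun C => (hF1 C C.2).1
  have hfull : μ (B \ ⋃ C : F, (C : Set Ω)) = 0 := by
    by_contra hne
    obtain ⟨C, hC, hCm, hC0, hCP⟩ := hP _ Set.sdiff_subset (hB.diff hUm) (pos_iff_ne_zero.2 hne)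
    have hCF : C ∈ F := by
      refine hmax (y := insert C F) ⟨?_, ?_⟩ (Set.subset_insert _ _) (Set.mem_insert _ _)
      · rintro D (rfl | hD)
        · exact ⟨hC.trans Set.sdiff_subset, hCm, hC0, hCP⟩
        · exact hF1 D hD
      · refine hF2.insert fun D hD _ => ?_
        refine Set.disjoint_left.2 fun x hx hxD => (hC hx).2 (Set.mem_iUnion.2 ⟨⟨D, hD⟩, hxD⟩)
    have : C = ∅ := by
      rw [Set.eq_empty_iff_forall_notMem]
      intro x hx
      exact (hC hx).2 (Set.mem_iUnion.2 ⟨⟨C, hCF⟩, hx⟩)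
    simp [this] at hC0
  have hsum : μ B = ∑' C : F, μ (C : Set Ω) := by
    rw [← measure_iUnion hdis fun C => (hF1 C C.2).2.1]
    have := measure_sdiff_add_inter (μ := μ) B hUm
    rw [hfull, zero_add, Set.inter_eq_right.2 hUB] at this
    exact this.symm
  have hex : ∃ t : Finset F, μ B < ∑ C ∈ t, μ (C : Set Ω) + ENNReal.ofReal η := by
    by_contra! hcon
    have h0 : 0 < μ B := by
      have := hcon ∅
      simp only [Finset.sum_empty, zero_add] at this
      exact lt_of_lt_of_le (ENNReal.ofReal_pos.2 hη) this
    have hlt : μ B - ENNReal.ofReal η < μ B :=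
      ENNReal.sub_lt_self hBf h0.ne' (ENNReal.ofReal_pos.2 hη).ne'
    conv at hlt => rhs; rw [hsum, ENNReal.tsum_eq_iSup_sum]
    obtain ⟨t, ht⟩ := lt_iSup_iff.1 hlt
    exact absurd (ENNReal.le_sub_of_add_le_right (by simp) (hcon t)) (not_le.2 ht)
  obtain ⟨t, ht⟩ := hex
  have hinj : Function.Injective (fun i : Fin t.card => ((t.equivFin.symm i : t) : F)) :=
    Subtype.val_injective.comp t.equivFin.symm.injective
  refine ⟨t.card, fun i => ((t.equivFin.symm i : t) : F), fun i => (hF1 _ (Subtype.property _)).1,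
    fun i => (hF1 _ (Subtype.property _)).2.1, fun i => (hF1 _ (Subtype.property _)).2.2.1,
    fun i => (hF1 _ (Subtype.property _)).2.2.2, fun i j hij => hdis (hinj.ne hij), ?_⟩
  have hU : (⋃ i : Fin t.card, (((t.equivFin.symm i : t) : F) : Set Ω)) = ⋃ C ∈ t, (C : Set Ω) := by
    rw [t.equivFin.symm.surjective.iUnion_comp (fun C : t => ((C : F) : Set Ω)), Set.iUnion_subtype]
  rw [hU]
  have hsub : (⋃ C ∈ t, (C : Set Ω)) ⊆ B := Set.iUnion₂_subset fun C _ => (hF1 C C.2).1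
  have hms : μ (⋃ C ∈ t, (C : Set Ω)) = ∑ C ∈ t, μ (C : Set Ω) :=
    measure_biUnion_finset (fun C _ D _ h => hdis h) fun C _ => (hF1 C C.2).2.1
  have hmm : MeasurableSet (⋃ C ∈ t, (C : Set Ω)) :=
    Finset.measurableSet_biUnion _ fun C _ => (hF1 C C.2).2.1
  rw [Measure.real, measure_sdiff hsub hmm.nullMeasurableSet (ne_top_of_le_ne_top hBf (measure_mono hsub))]
  refine (ENNReal.toReal_lt_of_lt_ofReal ?_)
  rw [hms]
  refine ENNReal.sub_lt_of_lt_add ?_ (by rwa [add_comm])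
  rw [← hms]; exact measure_mono hsub

theorem sum_meas_le (μ : Measure Ω) {B : Set Ω} (hBf : μ B ≠ ∞) {ι : Type*} [Fintype ι]
    (C : ι → Set Ω) (h1 : ∀ i, C i ⊆ B) (h2 : ∀ i, MeasurableSet (C i))
    (h3 : Pairwise (Function.onFun Disjoint C)) : ∑ i, μ.real (C i) ≤ μ.real B := by
  have : ∑ i, μ (C i) ≤ μ B := by
    rw [← measure_biUnion_finset (fun i _ j _ h => h3 h) (fun i _ => h2 i)]
    exact measure_mono (Set.iUnion₂_subset fun i _ => h1 i)
  unfold Measure.real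
  rw [← ENNReal.toReal_sum fun i _ => ne_top_of_le_ne_top hBf (measure_mono (h1 i))]
  exact ENNReal.toReal_mono hBf this

theorem meas_diff (μ : Measure Ω) {B : Set Ω} (hBf : μ B ≠ ∞) {ι : Type*} [Fintype ι]
    (C : ι → Set Ω) (h1 : ∀ i, C i ⊆ B) (h2 : ∀ i, MeasurableSet (C i)) :
    μ.real B ≤ ∑ i, μ.real (C i) + μ.real (B \ ⋃ i, C i) := by
  have h : (⋃ i, C i) ⊆ B := Set.iUnion_subset h1
  have e : μ.real B = μ.real (⋃ i, C i) + μ.real (B \ ⋃ i, C i) := by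
    have := measureReal_sdiff h (MeasurableSet.iUnion h2) hBf
    linarith
  rw [e]
  gcongr
  exact measureReal_iUnion_fintype_le _

theorem ee_split (μ : Measure Ω) {B : Set Ω} (hB : MeasurableSet B) (hBf : μ B ≠ ∞) {ι : Type*}
    [Fintype ι] (C : ι → Set Ω) (h1 : ∀ i, C i ⊆ B) (h2 : ∀ i, MeasurableSet (C i))
    (h3 : Pairwise (Function.onFun Disjoint C)) :
    ee μ B = ∑ i, ee μ (C i) + ee μ (B \ ⋃ i, C i) := by
  have h : (⋃ i, C i) ⊆ B := Set.iUnion_subset h1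
  have hm := MeasurableSet.iUnion h2
  rw [← ee_biUnion μ Finset.univ C h2 (fun i => ne_top_of_le_ne_top hBf (measure_mono (h1 i))) h3]
  simp only [Finset.mem_univ, Set.iUnion_true]
  rw [← ee_union μ hm (ne_top_of_le_ne_top hBf (measure_mono h)) (hB.diff hm)
    (ne_top_of_le_ne_top hBf (measure_mono Set.sdiff_subset)) Set.disjoint_sdiff_right,
    Set.union_sdiff_cancel h]

/-- variation sums -/
def PhiSet (μ : Measure Ω) (T : Lp ℝ 1 μ →L[ℝ] Lp ℝ 1 μ) (B : Set Ω) : Set ℝ :=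
  {r | ∃ (ι : Type) (_ : Fintype ι) (C : ι → Set Ω), (∀ i, C i ⊆ B) ∧ (∀ i, MeasurableSet (C i)) ∧
    Pairwise (Function.onFun Disjoint C) ∧ r = ∑ i, nrm μ B (T (ee μ (C i)))}

/-- variation -/
noncomputable def Phi (μ : Measure Ω) (T : Lp ℝ 1 μ →L[ℝ] Lp ℝ 1 μ) (B : Set Ω) : ℝ :=
  sSup (PhiSet μ T B)

section
variable {μ : Measure Ω} {T : Lp ℝ 1 μ →L[ℝ] Lp ℝ 1 μ}

theorem nrm_T_le {S C : Set Ω} (h : MeasurableSet C) (h' : μ C ≠ ∞) :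
    nrm μ S (T (ee μ C)) ≤ ‖T‖ * μ.real C := by
  rw [← norm_ee μ h h']
  exact (nrm_le _ _ _).trans (T.le_opNorm _)

theorem PhiSet_le {B : Set Ω} (hBf : μ B ≠ ∞) {r : ℝ} (hr : r ∈ PhiSet μ T B) :
    r ≤ ‖T‖ * μ.real B := by
  obtain ⟨ι, _, C, h1, h2, h3, rfl⟩ := hr
  calc _ ≤ ∑ i, ‖T‖ * μ.real (C i) := Finset.sum_le_sum fun i _ =>
        nrm_T_le (h2 i) (ne_top_of_le_ne_top hBf (measure_mono (h1 i)))
    _ = ‖T‖ * ∑ i, μ.real (C i) := by rw [Finset.mul_sum]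
    _ ≤ _ := by gcongr; exact sum_meas_le μ hBf C h1 h2 h3

theorem zero_mem_PhiSet {B : Set Ω} : 0 ∈ PhiSet μ T B :=
  ⟨Empty, inferInstance, fun _ => ∅, nofun, nofun, nofun, by simp⟩

theorem PhiSet_bdd {B : Set Ω} (hBf : μ B ≠ ∞) : BddAbove (PhiSet μ T B) :=
  ⟨_, fun _ hr => PhiSet_le hBf hr⟩

theorem Phi_nonneg {B : Set Ω} (hBf : μ B ≠ ∞) : 0 ≤ Phi μ T B :=
  le_csSup (PhiSet_bdd hBf) zero_mem_PhiSet

theorem Phi_approx {B : Set Ω} (hB : MeasurableSet B) {ε : ℝ} (hε : 0 < ε) :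
    ∃ (ι : Type) (_ : Fintype ι) (C : ι → Set Ω), (∀ i, C i ⊆ B) ∧ (∀ i, MeasurableSet (C i)) ∧
    Pairwise (Function.onFun Disjoint C) ∧ (⋃ i, C i) = B ∧
    Phi μ T B - ε < ∑ i, nrm μ B (T (ee μ (C i))) := by
  obtain ⟨r, ⟨ι, _, C, h1, h2, h3, rfl⟩, hr⟩ :=
    exists_lt_of_lt_csSup (s := PhiSet μ T B) ⟨0, zero_mem_PhiSet⟩ (sub_lt_self (Phi μ T B) hε)
  have hm := MeasurableSet.iUnion h2
  refine ⟨Option ι, inferInstance, fun o => o.elim (B \ ⋃ i, C i) C, ?_, ?_, ?_, ?_, ?_⟩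
  · rintro (_ | i)
    · exact Set.sdiff_subset
    · exact h1 i
  · rintro (_ | i)
    · exact hB.diff hm
    · exact h2 i
  · rintro (_ | i) (_ | j) hij
    · exact absurd rfl hij
    · exact Set.disjoint_left.2 fun x hx hx' => hx.2 (Set.mem_iUnion.2 ⟨j, hx'⟩)
    · exact Set.disjoint_left.2 fun x hx' hx => hx.2 (Set.mem_iUnion.2 ⟨i, hx'⟩)
    · exact h3 (fun h => hij (by rw [h]))
  · rw [Set.iUnion_option]
    exact Set.sdiff_union_of_subset (Set.iUnion_subset h1)
  · rw [Fintype.sum_option]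
    have := nrm_nonneg μ B (T (ee μ (B \ ⋃ i, C i)))
    simp only [Option.elim]
    linarith

theorem Phi_super {B : Set Ω} (hBf : μ B ≠ ∞) {ι : Type} [Fintype ι]
    (C : ι → Set Ω) (h1 : ∀ i, C i ⊆ B) (h2 : ∀ i, MeasurableSet (C i))
    (h3 : Pairwise (Function.onFun Disjoint C)) :
    ∑ i, Phi μ T (C i) + ∑ i, nrm μ (B \ C i) (T (ee μ (C i))) ≤ Phi μ T B := by
  refine le_of_forall_pos_le_add fun ε hε => ?_
  have hk : 0 < ε / (Fintype.card ι + 1) := by positivity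
  choose κ hκ D d1 d2 d3 d4 d5 using fun i => Phi_approx (T := T) (h2 i) hk
  have hCf : ∀ i, μ (C i) ≠ ∞ := fun i => ne_top_of_le_ne_top hBf (measure_mono (h1 i))
  have key : ∀ i, Phi μ T (C i) + nrm μ (B \ C i) (T (ee μ (C i))) ≤
      ∑ k, nrm μ B (T (ee μ (D i k))) + ε / (Fintype.card ι + 1) := by
    intro i
    have e : ee μ (C i) = ∑ k, ee μ (D i k) := by
      rw [ee_split μ (h2 i) (hCf i) (D i) (d1 i) (d2 i) (d3 i), d4 i, Set.sdiff_self]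
      simp [ee]
    have e1 : nrm μ (B \ C i) (T (ee μ (C i))) ≤ ∑ k, nrm μ (B \ C i) (T (ee μ (D i k))) := by
      rw [e, map_sum]; exact nrm_sum_le _ _ _ _
    have e2 : ∑ k, nrm μ B (T (ee μ (D i k))) = ∑ k, nrm μ (C i) (T (ee μ (D i k))) +
        ∑ k, nrm μ (B \ C i) (T (ee μ (D i k))) := by
      rw [← Finset.sum_add_distrib]
      exact Finset.sum_congr rfl fun k _ => nrm_diff μ (h2 i) (h1 i) _
    have := d5 i
    linarith
  have mem : ∑ i, ∑ k, nrm μ B (T (ee μ (D i k))) ∈ PhiSet μ T B := by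
    refine ⟨(i : ι) × κ i, inferInstance, fun p => D p.1 p.2, fun p => (d1 _ _).trans (h1 _),
      fun p => d2 _ _, ?_, ?_⟩
    · rintro ⟨i, k⟩ ⟨j, l⟩ hne
      by_cases hij : i = j
      · subst hij
        exact d3 i (fun h => hne (congrArg (Sigma.mk i) h))
      · exact (h3 hij).mono (d1 i k) (d1 j l)
    · rw [Fintype.sum_sigma]
  have := le_csSup (PhiSet_bdd hBf) mem
  change _ ≤ Phi μ T B at this
  rw [← Finset.sum_add_distrib]
  refine (Finset.sum_le_sum fun i _ => key i).trans ?_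
  rw [Finset.sum_add_distrib, Finset.sum_const, Finset.card_univ, nsmul_eq_mul]
  have : (Fintype.card ι : ℝ) * (ε / (Fintype.card ι + 1)) ≤ ε := by
    rw [mul_div_assoc', div_le_iff₀ (by positivity)]
    nlinarith
  linarith

theorem M_exhaust (hT : T ∈ Mclass μ) {B : Set Ω} (hB : MeasurableSet B) (hBf : μ B ≠ ∞)
    {δ η : ℝ} (hδ : 0 < δ) (hη : 0 < η) :
    ∃ (n : ℕ) (C : Fin n → Set Ω), (∀ i, C i ⊆ B) ∧ (∀ i, MeasurableSet (C i)) ∧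
      (∀ i, 0 < μ (C i)) ∧ (∀ i, nrm μ (C i) (T (ee μ (C i))) ≤ δ * μ.real (C i)) ∧
      Pairwise (Function.onFun Disjoint C) ∧ μ.real (B \ ⋃ i, C i) < η := by
  refine exhaust μ B hB hBf (fun C => nrm μ C (T (ee μ C)) ≤ δ * μ.real C) ?_ η hη
  intro A hAB hA hA0
  obtain ⟨C, hCA, hC, hCf, hC0, h⟩ := (mem_M_iff μ T).1 hT δ hδ A hA hA0
  exact ⟨C, hCA, hC, hC0, h.le⟩

theorem stable_small (hT : T ∈ Mclass μ) {V : Lp ℝ 1 μ →L[ℝ] Lp ℝ 1 μ} {B : Set Ω}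
    (hB : MeasurableSet B) (hBf : μ B ≠ ∞)
    {m δ : ℝ} (hm : 0 ≤ m) (hδ : 0 < δ) (hB0 : 0 < μ B)
    (hlow : ∀ C ⊆ B, MeasurableSet C → 0 < μ C → m * μ.real C ≤ Phi μ T C + Phi μ V C)
    (hup : Phi μ T B + Phi μ V B ≤ (m + δ) * μ.real B) :
    nrm μ B (T (ee μ B)) ≤ 3 * δ * μ.real B := by
  have hBr : 0 < μ.real B := ENNReal.toReal_pos hB0.ne' hBf
  have hη : 0 < δ * μ.real B / (m + ‖T‖ + 1) := by positivity
  obtain ⟨n, C, h1, h2, h0, h4, h3, h5⟩ := M_exhaust hT hB hBf hδ hη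
  have hR : (m + ‖T‖) * μ.real (B \ ⋃ i, C i) ≤ δ * μ.real B := by
    rw [lt_div_iff₀ (by positivity)] at h5
    have := measureReal_nonneg (μ := μ) (s := B \ ⋃ i, C i)
    linarith
  have s1 := Phi_super (T := T) hBf C h1 h2 h3
  have s2 := Phi_super (T := V) hBf C h1 h2 h3
  have s3 : 0 ≤ ∑ i, nrm μ (B \ C i) (V (ee μ (C i))) := Finset.sum_nonneg fun i _ => nrm_nonneg _ _ _
  have s4 : m * ∑ i, μ.real (C i) ≤ ∑ i, Phi μ T (C i) + ∑ i, Phi μ V (C i) := by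
    rw [Finset.mul_sum, ← Finset.sum_add_distrib]
    exact Finset.sum_le_sum fun i _ => hlow _ (h1 i) (h2 i) (h0 i)
  have s5 := mul_le_mul_of_nonneg_left (meas_diff μ hBf C h1 h2) hm
  have s6 : nrm μ B (T (ee μ B)) ≤ ∑ i, nrm μ B (T (ee μ (C i))) + ‖T‖ * μ.real (B \ ⋃ i, C i) := by
    rw [ee_split μ hB hBf C h1 h2 h3, map_add, map_sum]
    refine (nrm_add_le _ _ _ _).trans (add_le_add (nrm_sum_le _ _ _ _) ?_)
    exact nrm_T_le (hB.diff (MeasurableSet.iUnion h2))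
      (ne_top_of_le_ne_top hBf (measure_mono Set.sdiff_subset))
  have s7 : ∑ i, nrm μ B (T (ee μ (C i))) = ∑ i, nrm μ (C i) (T (ee μ (C i))) +
        ∑ i, nrm μ (B \ C i) (T (ee μ (C i))) := by
      rw [← Finset.sum_add_distrib]
      exact Finset.sum_congr rfl fun k _ => nrm_diff μ (h2 k) (h1 k) _
  have s8 : ∑ i, nrm μ (C i) (T (ee μ (C i))) ≤ δ * ∑ i, μ.real (C i) := by
    rw [Finset.mul_sum]; exact Finset.sum_le_sum fun i _ => h4 i
  have s9 := mul_le_mul_of_nonneg_left (sum_meas_le μ hBf C h1 h2 h3) hδ.le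
  linarith

theorem M_add (hT : T ∈ Mclass μ) {V : Lp ℝ 1 μ →L[ℝ] Lp ℝ 1 μ} (hV : V ∈ Mclass μ) :
    T + V ∈ Mclass μ := by
  rw [mem_M_iff]
  intro ε hε A hA hA0
  let S : Set ℝ := {r | ∃ B ⊆ A, MeasurableSet B ∧ μ B ≠ ∞ ∧ 0 < μ B ∧
    r = (Phi μ T B + Phi μ V B) / μ.real B}
  have hS : S.Nonempty := by
    obtain ⟨B, h1, h2, h3, h4, _⟩ := (mem_M_iff μ T).1 hT 1 one_pos A hA hA0
    exact ⟨_, B, h1, h2, h3, h4, rfl⟩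
  have hS0 : ∀ r ∈ S, 0 ≤ r := by
    rintro r ⟨B, h1, h2, h3, h4, rfl⟩
    exact div_nonneg (add_nonneg (Phi_nonneg h3) (Phi_nonneg h3)) measureReal_nonneg
  have hδ : 0 < ε / 7 := by positivity
  obtain ⟨r, ⟨B, h1, h2, h3, h4, rfl⟩, hr⟩ := exists_lt_of_csInf_lt hS
    (lt_add_of_pos_right (sInf S) hδ)
  have hp : 0 < μ.real B := ENNReal.toReal_pos h4.ne' h3
  rw [div_lt_iff₀ hp] at hr
  have hm : 0 ≤ sInf S := le_csInf hS hS0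
  have hlow : ∀ C ⊆ B, MeasurableSet C → 0 < μ C →
      sInf S * μ.real C ≤ Phi μ T C + Phi μ V C := by
    intro C hCB hC hC0
    have hCf := ne_top_of_le_ne_top h3 (measure_mono hCB)
    have : sInf S ≤ (Phi μ T C + Phi μ V C) / μ.real C :=
      csInf_le ⟨0, hS0⟩ ⟨C, hCB.trans h1, hC, hCf, hC0, rfl⟩
    have hCp : 0 < μ.real C := ENNReal.toReal_pos hC0.ne' hCf
    rwa [le_div_iff₀ hCp] at this
  have a1 := stable_small hT (V := V) h2 h3 hm hδ h4 hlow hr.le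
  have a2 := stable_small hV (V := T) h2 h3 hm hδ h4
    (fun C a b c => by rw [add_comm (Phi μ V C)]; exact hlow C a b c) (by rw [add_comm]; exact hr.le)
  refine ⟨B, h1, h2, h3, h4, ?_⟩
  have a3 := nrm_add_le μ B (T (ee μ B)) (V (ee μ B))
  rw [_root_.add_apply]
  have : 0 < ε * μ.real B := by positivity
  linarith

theorem M_smul (c : ℝ) (hT : T ∈ Mclass μ) : c • T ∈ Mclass μ := by
  rw [mem_M_iff] at *
  intro ε hε A hA hA0
  obtain ⟨B, h1, h2, h3, h4, h5⟩ := hT (ε / (|c| + 1)) (by positivity) A hA hA0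
  refine ⟨B, h1, h2, h3, h4, ?_⟩
  rw [_root_.smul_apply, nrm_smul]
  rw [div_mul_eq_mul_div, lt_div_iff₀ (by positivity)] at h5
  have := nrm_nonneg μ B (T (ee μ B))
  nlinarith

theorem M_closed : IsClosed (Mclass μ) := by
  refine isClosed_of_closure_subset fun T hT => ?_
  rw [mem_M_iff]
  intro ε hε A hA hA0
  obtain ⟨V, hV, hd⟩ := Metric.mem_closure_iff.1 hT (ε / 2) (by positivity)
  obtain ⟨B, h1, h2, h3, h4, h5⟩ := (mem_M_iff μ V).1 hV (ε / 2) (by positivity) A hA hA0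
  refine ⟨B, h1, h2, h3, h4, ?_⟩
  have e : T (ee μ B) = (T - V) (ee μ B) + V (ee μ B) := by simp
  rw [e]
  have a1 := nrm_add_le μ B ((T - V) (ee μ B)) (V (ee μ B))
  have a2 := nrm_T_le (T := T - V) (S := B) h2 h3
  rw [dist_eq_norm] at hd
  have := mul_le_mul_of_nonneg_right hd.le (measureReal_nonneg (μ := μ) (s := B))
  linarith

theorem M_zero (hsemi : ∀ A : Set Ω, MeasurableSet A → μ A = ∞ →
      ∃ B ⊆ A, MeasurableSet B ∧ 0 < μ B ∧ μ B < ∞) :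
    (0 : Lp ℝ 1 μ →L[ℝ] Lp ℝ 1 μ) ∈ Mclass μ := by
  rw [mem_M_iff]
  intro ε hε A hA hA0
  have h : ∃ B ⊆ A, MeasurableSet B ∧ 0 < μ B ∧ μ B < ∞ := by
    by_cases hi : μ A = ∞
    · exact hsemi A hA hi
    · exact ⟨A, subset_rfl, hA, hA0, Ne.lt_top hi⟩
  obtain ⟨B, h1, h2, h3, h4⟩ := h
  refine ⟨B, h1, h2, h4.ne, h3, ?_⟩
  have h0 := nrm_smul μ B 0 0
  simp at h0
  have hp : 0 < μ.real B := ENNReal.toReal_pos h3.ne' h4.ne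
  rw [_root_.zero_apply, h0]
  positivity

/-- multiplication by the indicator of A, as a function -/
noncomputable def mulF (μ : Measure Ω) {A : Set Ω} (hA : MeasurableSet A) (f : Lp ℝ 1 μ) :
    Lp ℝ 1 μ := MemLp.toLp (A.indicator f) (MemLp.indicator hA (Lp.memLp f))

theorem mulF_coe {A : Set Ω} (hA : MeasurableSet A) (f : Lp ℝ 1 μ) :
    mulF μ hA f =ᵐ[μ] A.indicator f := by
  unfold mulF
  exact MemLp.coeFn_toLp _

theorem mulF_add {A : Set Ω} (hA : MeasurableSet A) (f g : Lp ℝ 1 μ) :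
    mulF μ hA (f + g) = mulF μ hA f + mulF μ hA g := by
  ext1
  filter_upwards [mulF_coe hA f, mulF_coe hA g, mulF_coe hA (f + g), Lp.coeFn_add f g,
    Lp.coeFn_add (mulF μ hA f) (mulF μ hA g)] with x h1 h2 h3 h4 h5
  rw [h3, h5, Pi.add_apply, h1, h2]
  by_cases hx : x ∈ A
  · rw [Set.indicator_of_mem hx, Set.indicator_of_mem hx, Set.indicator_of_mem hx, h4, Pi.add_apply]
  · simp [hx]

theorem mulF_smul {A : Set Ω} (hA : MeasurableSet A) (c : ℝ) (f : Lp ℝ 1 μ) :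
    mulF μ hA (c • f) = c • mulF μ hA f := by
  ext1
  filter_upwards [mulF_coe hA f, mulF_coe hA (c • f), Lp.coeFn_smul c f,
    Lp.coeFn_smul c (mulF μ hA f)] with x h1 h3 h4 h5
  rw [h3, h5, Pi.smul_apply, h1]
  by_cases hx : x ∈ A <;> simp [hx, h4]

theorem mulF_norm {A : Set Ω} (hA : MeasurableSet A) (f : Lp ℝ 1 μ) :
    ‖mulF μ hA f‖ ≤ 1 * ‖f‖ := by
  rw [one_mul]
  refine Lp.norm_le_norm_of_ae_le ?_
  filter_upwards [mulF_coe hA f] with x h1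
  rw [h1]
  exact norm_indicator_le_norm_self _ _

/-- multiplication by the indicator of A -/
noncomputable def mulA (μ : Measure Ω) {A : Set Ω} (hA : MeasurableSet A) :
    Lp ℝ 1 μ →L[ℝ] Lp ℝ 1 μ :=
  LinearMap.mkContinuous
    { toFun := mulF μ hA
      map_add' := mulF_add hA
      map_smul' := mulF_smul hA } 1 (mulF_norm hA)

theorem mulA_coe {A : Set Ω} (hA : MeasurableSet A) (f : Lp ℝ 1 μ) :
    mulA μ hA f =ᵐ[μ] A.indicator f := mulF_coe hA f

theorem mulA_ee {A C : Set Ω} (hA : MeasurableSet A) (hC : MeasurableSet C) (hCf : μ C ≠ ∞) :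
    mulA μ hA (ee μ C) = ee μ (A ∩ C) := by
  rw [ee_def μ hC hCf, ee_def μ (hA.inter hC) (ne_top_of_le_ne_top hCf (measure_mono Set.inter_subset_right))]
  ext1
  filter_upwards [mulA_coe hA (indicatorConstLp 1 hC hCf (1 : ℝ)),
    indicatorConstLp_coeFn (p := 1) (hs := hC) (hμs := hCf) (c := (1 : ℝ)),
    indicatorConstLp_coeFn (p := 1) (hs := hA.inter hC)
      (hμs := ne_top_of_le_ne_top hCf (measure_mono Set.inter_subset_right)) (c := (1 : ℝ))] with x h1 h2 h3
  rw [h1, h3]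
  by_cases hx : x ∈ A <;> by_cases hx' : x ∈ C <;> simp [hx, hx', h2]

theorem mulA_self {A : Set Ω} (hA : MeasurableSet A) {f : Lp ℝ 1 μ} (hf : f ∈ LoneSub μ A) :
    mulA μ hA f = f := by
  ext1
  have hf' : ∀ᵐ x ∂μ, x ∉ A → f x = 0 := hf
  filter_upwards [mulA_coe hA f, hf'] with x h1 h2
  rw [h1]
  by_cases hx : x ∈ A <;> simp [hx, h2]

theorem bound_ext {A : Set Ω} (hA : MeasurableSet A) {K : ℝ}
    (h : ∀ C ⊆ A, MeasurableSet C → μ C ≠ ∞ → ‖T (ee μ C)‖ ≤ K * μ.real C) (hK : 0 ≤ K)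
    (f : Lp ℝ 1 μ) : ‖T (mulA μ hA f)‖ ≤ K * ‖f‖ := by
  induction f using Lp.induction ENNReal.one_ne_top with
  | @indicatorConst c s hs hμs =>
    rw [Lp.simpleFunc.coe_indicatorConst, indConst_eq, map_smul, map_smul, norm_smul, norm_smul,
      mulA_ee hA hs hμs.ne, norm_ee μ hs hμs.ne]
    have h1 := h (A ∩ s) Set.inter_subset_left (hA.inter hs)
      (ne_top_of_le_ne_top hμs.ne (measure_mono Set.inter_subset_right))
    have h2 : μ.real (A ∩ s) ≤ μ.real s := measureReal_mono Set.inter_subset_right hμs.ne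
    calc ‖c‖ * ‖T (ee μ (A ∩ s))‖ ≤ ‖c‖ * (K * μ.real s) := by
          gcongr; exact h1.trans (by gcongr)
      _ = _ := by ring
  | @add f g hf hg hd h1 h2 =>
    have hn : ‖hf.toLp f + hg.toLp g‖ = ‖hf.toLp f‖ + ‖hg.toLp g‖ := by
      rw [norm_eq, norm_eq, norm_eq, ← integral_add (intg μ _) (intg μ _)]
      refine integral_congr_ae ?_
      filter_upwards [Lp.coeFn_add (hf.toLp f) (hg.toLp g), hf.coeFn_toLp, hg.coeFn_toLp] with x a b c
      rw [a, Pi.add_apply, b, c]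
      by_cases hx : f x = 0
      · simp [hx]
      · have : g x = 0 := by
          by_contra hx'
          exact Set.disjoint_left.1 hd hx hx'
        simp [this]
    rw [map_add, map_add, hn, mul_add]
    exact (norm_add_le _ _).trans (add_le_add h1 h2)
  | isClosed =>
    exact isClosed_le (by fun_prop) (by fun_prop)

theorem ee_mem {A C : Set Ω} (h : C ⊆ A) (hC : MeasurableSet C) (hCf : μ C ≠ ∞) :
    ee μ C ∈ LoneSub μ A := by
  rw [ee_def μ hC hCf]
  change ∀ᵐ x ∂μ, x ∉ A → _
  filter_upwards [indicatorConstLp_coeFn (p := 1) (hs := hC) (hμs := hCf) (c := (1 : ℝ))] with x h1 hx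
  rw [h1]
  have hxC : x ∉ C := fun h' => hx (h h')
  simp [hxC]

theorem nrm_ee {C : Set Ω} (hC : MeasurableSet C) (hCf : μ C ≠ ∞) :
    nrm μ C (ee μ C) = μ.real C := by
  rw [ee_def μ hC hCf, nrm]
  have : ∫ x in C, |(indicatorConstLp 1 hC hCf (1 : ℝ) : Lp ℝ 1 μ) x| ∂μ = ∫ x in C, 1 ∂μ := by
    refine setIntegral_congr_ae hC ?_
    filter_upwards [indicatorConstLp_coeFn (p := 1) (hs := hC) (hμs := hCf) (c := (1 : ℝ))] with x h1 hx
    rw [h1]; simp [hx]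
  rw [this]; simp

theorem nrm_compl_ee {C : Set Ω} (hC : MeasurableSet C) (hCf : μ C ≠ ∞) :
    nrm μ (Set.univ \ C) (ee μ C) = 0 := by
  have := nrm_diff μ hC (Set.subset_univ C) (ee μ C)
  rw [nrm_univ, norm_ee μ hC hCf, nrm_ee hC hCf] at this
  linarith

theorem daug_block {B : Set Ω} (hB : MeasurableSet B) (hBf : μ B ≠ ∞) {δ : ℝ}
    (h : nrm μ B (T (ee μ B)) ≤ δ * μ.real B) :
    ‖T (ee μ B)‖ + (1 - 2 * δ) * μ.real B ≤ ‖ee μ B + T (ee μ B)‖ := by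
  have a1 := nrm_diff μ hB (Set.subset_univ B) (ee μ B + T (ee μ B))
  have a2 := nrm_diff μ hB (Set.subset_univ B) (T (ee μ B))
  rw [nrm_univ] at a1 a2
  have n1 : ∀ S, nrm μ S (-T (ee μ B)) = nrm μ S (T (ee μ B)) := fun S => by
    have := nrm_smul μ S (-1) (T (ee μ B)); simpa using this
  have n2 : ∀ S, nrm μ S (-ee μ B) = nrm μ S (ee μ B) := fun S => by
    have := nrm_smul μ S (-1) (ee μ B); simpa using this
  have a3 := nrm_add_le μ B (ee μ B + T (ee μ B)) (-T (ee μ B))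
  have a4 := nrm_add_le μ (Set.univ \ B) (ee μ B + T (ee μ B)) (-ee μ B)
  rw [add_neg_cancel_right, n1, nrm_ee hB hBf] at a3
  rw [add_neg_cancel_comm, n2, nrm_compl_ee hB hBf] at a4
  linarith

theorem daugavet (hT : T ∈ Mclass μ) {A : Set Ω} (hA : MeasurableSet A) (hA0 : 0 < μ A) :
    ‖(LoneSub μ A).subtypeL + T.comp (LoneSub μ A).subtypeL‖
          = 1 + ‖T.comp (LoneSub μ A).subtypeL‖ := by
  apply le_antisymm
  · refine (norm_add_le (LoneSub μ A).subtypeL (T.comp (LoneSub μ A).subtypeL)).trans ?_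
    refine add_le_add ?_ le_rfl
    refine ContinuousLinearMap.opNorm_le_bound _ zero_le_one fun f => ?_
    rw [one_mul]; rfl
  set N := ‖(LoneSub μ A).subtypeL + T.comp (LoneSub μ A).subtypeL‖ with hN
  have blk : ∀ B ⊆ A, MeasurableSet B → μ B ≠ ∞ → ∀ δ : ℝ,
      nrm μ B (T (ee μ B)) ≤ δ * μ.real B → ‖T (ee μ B)‖ ≤ (N - 1 + 2 * δ) * μ.real B := by
    intro B hBA hB hBf δ h
    have a1 := daug_block hB hBf h
    have a2 := ((LoneSub μ A).subtypeL + T.comp (LoneSub μ A).subtypeL).le_opNorm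
      ⟨ee μ B, ee_mem hBA hB hBf⟩
    rw [← hN] at a2
    change ‖ee μ B + T (ee μ B)‖ ≤ N * ‖ee μ B‖ at a2
    rw [norm_ee μ hB hBf] at a2
    linarith
  have hpos : ∀ δ > 0, 0 ≤ N - 1 + 2 * δ := by
    intro δ hδ
    obtain ⟨B, h1, h2, h3, h4, h5⟩ := (mem_M_iff μ T).1 hT δ hδ A hA hA0
    have a := (norm_nonneg (T (ee μ B))).trans (blk B h1 h2 h3 δ h5.le)
    exact nonneg_of_mul_nonneg_left a (ENNReal.toReal_pos h4.ne' h3)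
  have hK : 0 ≤ N - 1 := by
    refine le_of_forall_pos_le_add fun δ hδ => ?_
    have := hpos (δ / 2) (by positivity)
    linarith
  have hC : ∀ C ⊆ A, MeasurableSet C → μ C ≠ ∞ → ‖T (ee μ C)‖ ≤ (N - 1) * μ.real C := by
    intro C hCA hC hCf
    refine le_of_forall_pos_le_add fun ε hε => ?_
    obtain ⟨n, D, h1, h2, h0, h4, h3, h5⟩ := M_exhaust hT hC hCf
      (δ := ε / (4 * (μ.real C + 1))) (η := ε / (2 * (‖T‖ + 1))) (by positivity) (by positivity)
    set δ := ε / (4 * (μ.real C + 1)) with hδ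
    have b1 : 2 * δ * μ.real C ≤ ε / 2 := by
      rw [hδ]
      have : μ.real C / (μ.real C + 1) ≤ 1 := (div_le_one (by positivity)).2 (by linarith)
      calc 2 * (ε / (4 * (μ.real C + 1))) * μ.real C = ε / 2 * (μ.real C / (μ.real C + 1)) := by
            field_simp; norm_num
        _ ≤ ε / 2 * 1 := by gcongr
        _ = _ := by ring
    have b2 : ‖T‖ * μ.real (C \ ⋃ i, D i) ≤ ε / 2 := by
      rw [lt_div_iff₀ (by positivity)] at h5
      have := measureReal_nonneg (μ := μ) (s := C \ ⋃ i, D i)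
      linarith
    have b3 : ‖T (ee μ C)‖ ≤ ∑ i, ‖T (ee μ (D i))‖ + ‖T‖ * μ.real (C \ ⋃ i, D i) := by
      rw [ee_split μ hC hCf D h1 h2 h3, map_add, map_sum]
      refine (norm_add_le _ _).trans (add_le_add (norm_sum_le _ _) ?_)
      rw [← norm_ee μ (hC.diff (MeasurableSet.iUnion h2))
        (ne_top_of_le_ne_top hCf (measure_mono Set.sdiff_subset))]
      exact T.le_opNorm _
    have b4 : ∑ i, ‖T (ee μ (D i))‖ ≤ (N - 1 + 2 * δ) * ∑ i, μ.real (D i) := by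
      rw [Finset.mul_sum]
      exact Finset.sum_le_sum fun i _ => blk _ ((h1 i).trans hCA) (h2 i)
        (ne_top_of_le_ne_top hCf (measure_mono (h1 i))) δ (h4 i)
    have b5 := mul_le_mul_of_nonneg_left (sum_meas_le μ hCf D h1 h2 h3)
      (hpos δ (by positivity))
    linarith
  have fin : ‖T.comp (LoneSub μ A).subtypeL‖ ≤ N - 1 := by
    refine ContinuousLinearMap.opNorm_le_bound _ hK fun f => ?_
    have := bound_ext hA hC hK (f : Lp ℝ 1 μ)
    rwa [mulA_self hA f.2] at this
  linarith

end

/-- `M` is a closed linear subspace and each of its members satisfies the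
Daugavet equation on every `L¹(A)`. -/
theorem stmt7 (μ : Measure Ω) (hsemi : ∀ A : Set Ω, MeasurableSet A → μ A = ∞ →
      ∃ B ⊆ A, MeasurableSet B ∧ 0 < μ B ∧ μ B < ∞) :
    IsClosed (Mclass μ) ∧ (0 : Lp ℝ 1 μ →L[ℝ] Lp ℝ 1 μ) ∈ Mclass μ ∧
      (∀ U ∈ Mclass μ, ∀ V ∈ Mclass μ, U + V ∈ Mclass μ) ∧
      (∀ (c : ℝ), ∀ T ∈ Mclass μ, c • T ∈ Mclass μ) ∧
      ∀ T ∈ Mclass μ, ∀ A : Set Ω, MeasurableSet A → 0 < μ A →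
        ‖(LoneSub μ A).subtypeL + T.comp (LoneSub μ A).subtypeL‖
          = 1 + ‖T.comp (LoneSub μ A).subtypeL‖ := by
  exact ⟨M_closed, M_zero hsemi, fun U hU V hV => M_add hU hV, fun c T hT => M_smul c hT,
    fun T hT A hA hA0 => daugavet hT hA hA0⟩
end

section
/- Let (Ω, Σ, μ) be a measure space without atoms of infinite measure and let N be any linear subspace of bounded operators on L¹(Ω) such that every T ∈ N satisfies ‖Id_A + T_A‖ = 1 + ‖T_A‖ for every A ∈ Σ of positive measure. Then every T ∈ N satisfies: for every ε > 0 and every A ∈ Σ of positive measure there exists B ⊆ A with 0 < μ(B) < ∞ such that ‖χ_B · T(χ_B/μ(B))‖ < ε. -/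
open MeasureTheory ENNReal

variable {Ω : Type*} [MeasurableSpace Ω]

open Filter Topology

/-- indicator of a set of finite measure in `L¹`. -/
noncomputable def oneInd (μ : Measure Ω) {B : Set Ω} (hB : MeasurableSet B)
    (hBfin : μ B ≠ ∞) : Lp ℝ 1 μ :=
  indicatorConstLp 1 hB hBfin (1 : ℝ)

lemma oneInd_smul (μ : Measure Ω) {B : Set Ω} (hB : MeasurableSet B)
    (hBfin : μ B ≠ ∞) (c : ℝ) : indicatorConstLp 1 hB hBfin c = c • oneInd μ hB hBfin := by
  ext1
  filter_upwards [indicatorConstLp_coeFn (p := 1) (hs := hB) (hμs := hBfin) (c := c),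
    indicatorConstLp_coeFn (p := 1) (hs := hB) (hμs := hBfin) (c := (1 : ℝ)),
    Lp.coeFn_smul c (oneInd μ hB hBfin)] with x h1 h2 h3
  rw [h1, h3, Pi.smul_apply, oneInd, h2]
  by_cases hx : x ∈ B <;> simp [hx]

lemma norm_oneInd (μ : Measure Ω) {B : Set Ω} (hB : MeasurableSet B)
    (hBfin : μ B ≠ ∞) : ‖oneInd μ hB hBfin‖ = μ.real B := by
  rw [oneInd, norm_indicatorConstLp (by simp) (by simp)]
  simp

lemma oneInd_sum (μ : Measure Ω) (f : ℕ → Set Ω) (hf : ∀ i, MeasurableSet (f i))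
    (hfin : ∀ i, μ (f i) ≠ ∞) (hd : Pairwise (Function.onFun Disjoint f)) (s : Finset ℕ)
    (hm : MeasurableSet (⋃ i ∈ s, f i)) (hs : μ (⋃ i ∈ s, f i) ≠ ∞) :
    oneInd μ hm hs = ∑ i ∈ s, oneInd μ (hf i) (hfin i) := by
  classical
  induction s using Finset.induction_on with
  | empty =>
    rw [Finset.sum_empty, ← norm_eq_zero, norm_oneInd]
    simp
  | insert a s ha ih =>
    rw [Finset.sum_insert ha]
    have hm' : MeasurableSet (⋃ i ∈ s, f i) := Finset.measurableSet_biUnion _ fun i _ => hf i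
    have hs' : μ (⋃ i ∈ s, f i) ≠ ∞ := by
      refine ne_top_of_le_ne_top hs (measure_mono ?_)
      simp
    rw [← ih hm' hs']
    have := indicatorConstLp_disjoint_union (p := 1) (μ := μ) (hf a) hm' (hfin a) hs' (by
      rw [Set.disjoint_iUnion₂_right]
      intro i hi
      exact hd (by rintro rfl; exact ha hi)) (1 : ℝ)
    unfold oneInd
    rw [← this]
    congr 1
    simp

lemma oneInd_congr (μ : Measure Ω) {B C : Set Ω} (hB : MeasurableSet B)
    (hBfin : μ B ≠ ∞) (h : B = C) (hC : MeasurableSet C) (hCfin : μ C ≠ ∞) :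
    oneInd μ hB hBfin = oneInd μ hC hCfin := by
  subst h; rfl

lemma exists_sm (μ : Measure Ω) {A : Set Ω} (hA : MeasurableSet A) (hfin : μ A ≠ ∞)
    (φ : Lp ℝ 1 μ →L[ℝ] ℝ) :
    ∃ s : SignedMeasure Ω, ∀ X, X ⊆ A → ∀ (hX : MeasurableSet X) (hXf : μ X ≠ ∞),
      s X = φ (oneInd μ hX hXf) := by
  classical
  have hf2 : ∀ X, μ (X ∩ A) ≠ ∞ := fun X =>
    ne_top_of_le_ne_top hfin (measure_mono Set.inter_subset_right)
  refine ⟨⟨fun X => if h : MeasurableSet X then φ (oneInd μ (h.inter hA) (hf2 X)) else 0,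
    ?_, ?_, ?_⟩, ?_⟩
  · rw [dif_pos MeasurableSet.empty]
    have : oneInd μ (MeasurableSet.empty.inter hA) (hf2 ∅) = 0 := by
      rw [← norm_eq_zero, norm_oneInd]; simp
    rw [this, map_zero]
  · intro i hi
    rw [dif_neg hi]
  · intro f hf hd
    have hf' : ∀ i, MeasurableSet (f i ∩ A) := fun i => (hf i).inter hA
    have hd' : Pairwise (Function.onFun Disjoint (fun i => f i ∩ A)) := fun i j hij =>
      (hd hij).mono Set.inter_subset_left Set.inter_subset_left
    simp only [hf, MeasurableSet.iUnion hf, dif_pos]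
    have key : HasSum (fun i => oneInd μ (hf' i) (hf2 (f i)))
        (oneInd μ ((MeasurableSet.iUnion hf).inter hA) (hf2 (⋃ i, f i))) := by
      unfold HasSum
      have hm : ∀ s : Finset ℕ, MeasurableSet (⋃ i ∈ s, f i ∩ A) := fun s =>
        Finset.measurableSet_biUnion _ fun i _ => hf' i
      have hms : ∀ s : Finset ℕ, μ (⋃ i ∈ s, f i ∩ A) ≠ ∞ := fun s =>
        ne_top_of_le_ne_top hfin (measure_mono (by simp))
      have h1 : ∀ s : Finset ℕ, ∑ i ∈ s, oneInd μ (hf' i) (hf2 (f i)) = oneInd μ (hm s) (hms s) :=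
        fun s => (oneInd_sum μ _ hf' (fun i => hf2 (f i)) hd' s (hm s) (hms s)).symm
      simp only [SummationFilter.unconditional_filter]
      rw [funext h1]
      unfold oneInd
      refine tendsto_indicatorConstLp_set (by simp) ?_
      have h2 : HasSum (fun i => μ (f i ∩ A)) (μ (⋃ i, f i ∩ A)) := by
        rw [measure_iUnion hd' hf']
        exact ENNReal.summable.hasSum
      have h3 : ∀ s : Finset ℕ, μ (symmDiff (⋃ i ∈ s, f i ∩ A) ((⋃ i, f i) ∩ A)) =
          μ (⋃ i, f i ∩ A) - ∑ i ∈ s, μ (f i ∩ A) := by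
        intro s
        have hsub : (⋃ i ∈ s, f i ∩ A) ⊆ ⋃ i, f i ∩ A :=
          Set.iUnion₂_subset fun i _ => Set.subset_iUnion (fun i => f i ∩ A) i
        rw [Set.iUnion_inter, symmDiff_of_le hsub,
          measure_sdiff hsub (hm s).nullMeasurableSet (hms s),
          measure_biUnion_finset (fun i _ j _ hij => hd' hij) (fun i _ => hf' i)]
      rw [funext h3]
      have h4 : μ (⋃ i, f i ∩ A) ≠ ∞ := ne_top_of_le_ne_top hfin (measure_mono (by simp))
      have := ENNReal.Tendsto.sub (tendsto_const_nhds (x := μ (⋃ i, f i ∩ A))) h2 (Or.inl h4)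
      simpa using this
    exact key.mapL φ
  · intro X hXA hX hXf
    change (if h : MeasurableSet X then φ (oneInd μ (h.inter hA) (hf2 X)) else 0) = _
    rw [dif_pos hX]
    congr 1
    exact oneInd_congr μ _ _ (Set.inter_eq_left.2 hXA) _ _

/-- integration against a bounded function. -/
lemma exists_intCLM (μ : Measure Ω) (σ : Ω → ℝ) (hσ : Measurable σ) (hb : ∀ x, |σ x| ≤ 1) :
    ∃ L : Lp ℝ 1 μ →L[ℝ] ℝ, ∀ h : Lp ℝ 1 μ, L h = ∫ x, σ x * h x ∂μ := by
  have hi : ∀ h : Lp ℝ 1 μ, Integrable (fun x => σ x * h x) μ := fun h =>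
    (L1.integrable_coeFn h).bdd_mul hσ.aestronglyMeasurable (Eventually.of_forall hb)
  refine ⟨LinearMap.mkContinuous
    { toFun := fun h => ∫ x, σ x * h x ∂μ, map_add' := ?_, map_smul' := ?_ } 1 ?_, fun h => rfl⟩
  · intro f g
    rw [← integral_add (hi f) (hi g)]
    apply integral_congr_ae
    filter_upwards [Lp.coeFn_add f g] with x hx
    rw [hx, Pi.add_apply]; ring
  · intro c f
    rw [RingHom.id_apply, smul_eq_mul, ← integral_const_mul]
    apply integral_congr_ae
    filter_upwards [Lp.coeFn_smul c f] with x hx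
    rw [hx, Pi.smul_apply, smul_eq_mul]; ring
  · intro f
    rw [one_mul, L1.norm_eq_integral_norm]
    refine norm_integral_le_of_norm_le (L1.integrable_coeFn f).norm (Eventually.of_forall ?_)
    intro x
    change ‖σ x * f x‖ ≤ _
    rw [norm_mul]
    exact mul_le_of_le_one_left (norm_nonneg _) (hb x)

/-- restriction to `A`. -/
lemma exists_restr (μ : Measure Ω) {A : Set Ω} (hA : MeasurableSet A) :
    ∃ R : Lp ℝ 1 μ →L[ℝ] Lp ℝ 1 μ, ∀ h : Lp ℝ 1 μ, R h =ᵐ[μ] A.indicator h := by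
  let r : Lp ℝ 1 μ → Lp ℝ 1 μ := fun h => ((Lp.memLp h).indicator hA).toLp (A.indicator h)
  have hr : ∀ h, r h =ᵐ[μ] A.indicator h := fun h => MemLp.coeFn_toLp _
  have hadd : ∀ f g, r (f + g) = r f + r g := by
    intro f g
    ext1
    filter_upwards [Lp.coeFn_add f g, Lp.coeFn_add (r f) (r g), hr f, hr g, hr (f + g)]
      with x e1 e2 e3 e4 e5
    rw [e5, e2, Pi.add_apply, e3, e4]
    by_cases h : x ∈ A
    · simp only [Set.indicator_of_mem h]
      exact e1
    · simp [h]
  have hsmul : ∀ (c : ℝ) f, r (c • f) = c • r f := by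
    intro c f
    ext1
    filter_upwards [Lp.coeFn_smul c f, Lp.coeFn_smul c (r f), hr f, hr (c • f)]
      with x e1 e2 e3 e4
    rw [e4, e2, Pi.smul_apply, e3]
    by_cases h : x ∈ A <;> simp [h, e1]
  have hn : ∀ f, ‖r f‖ ≤ 1 * ‖f‖ := by
    intro f
    rw [one_mul]
    refine Lp.norm_le_norm_of_ae_le ?_
    filter_upwards [hr f] with x hx
    rw [hx]
    exact norm_indicator_le_norm_self _ _
  let l : Lp ℝ 1 μ →ₗ[ℝ] Lp ℝ 1 μ := { toFun := r, map_add' := hadd, map_smul' := hsmul }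
  exact ⟨l.mkContinuous 1 hn, hr⟩

lemma exists_big_set (μ : Measure Ω) {A : Set Ω} (hA : MeasurableSet A)
    (φ : Lp ℝ 1 μ →L[ℝ] ℝ) (c : ℝ) (hc : 0 ≤ c) (f : Lp ℝ 1 μ) (hf : f ∈ LoneSub μ A)
    (hlt : c * ‖f‖ < φ f) :
    ∃ B, B ⊆ A ∧ ∃ (hB : MeasurableSet B) (hBf : μ B ≠ ∞), c * μ.real B < |φ (oneInd μ hB hBf)| := by
  by_contra hcon
  push Not at hcon
  obtain ⟨R, hR⟩ := exists_restr μ hA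
  have key : ∀ h : Lp ℝ 1 μ, φ (R h) ≤ c * ‖h‖ := by
    intro h
    induction h using Lp.induction one_ne_top with
    | indicatorConst a hs hμs =>
      rename_i s
      rw [Lp.simpleFunc.coe_indicatorConst, oneInd_smul, map_smul, map_smul, norm_smul,
        norm_oneInd, smul_eq_mul]
      have h1 : μ (s ∩ A) ≠ ∞ := ne_top_of_le_ne_top hμs.ne (measure_mono Set.inter_subset_left)
      have h2 : R (oneInd μ hs hμs.ne) = oneInd μ (hs.inter hA) h1 := by
        ext1
        filter_upwards [hR (oneInd μ hs hμs.ne),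
          indicatorConstLp_coeFn (p := 1) (hs := hs) (hμs := hμs.ne) (c := (1 : ℝ)),
          indicatorConstLp_coeFn (p := 1) (hs := hs.inter hA) (hμs := h1) (c := (1 : ℝ))]
          with x e1 e2 e3
        rw [e1, oneInd, oneInd, e3]
        by_cases hxA : x ∈ A <;> by_cases hxs : x ∈ s <;> simp [hxA, hxs, e2]
      rw [h2]
      have h3 := hcon _ Set.inter_subset_right (hs.inter hA) h1
      have h4 : μ.real (s ∩ A) ≤ μ.real s := measureReal_mono Set.inter_subset_left hμs.ne
      calc a * φ (oneInd μ (hs.inter hA) h1) ≤ |a| * |φ (oneInd μ (hs.inter hA) h1)| := by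
            rw [← abs_mul]; exact le_abs_self _
        _ ≤ |a| * (c * μ.real s) := by
            gcongr
            exact h3.trans (by gcongr)
        _ = c * (‖a‖ * μ.real s) := by rw [Real.norm_eq_abs]; ring
    | add hf hg hd h1 h2 =>
      rename_i f g
      rw [map_add, map_add]
      have : ‖hf.toLp f + hg.toLp g‖ = ‖hf.toLp f‖ + ‖hg.toLp g‖ := by
        rw [L1.norm_eq_integral_norm, L1.norm_eq_integral_norm, L1.norm_eq_integral_norm,
          ← integral_add (L1.integrable_coeFn _).norm (L1.integrable_coeFn _).norm]
        apply integral_congr_ae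
        filter_upwards [Lp.coeFn_add (hf.toLp f) (hg.toLp g), hf.coeFn_toLp, hg.coeFn_toLp]
          with x e1 e2 e3
        rw [e1, Pi.add_apply, e2, e3]
        by_cases hx : f x = 0
        · simp [hx]
        · have : g x = 0 := by
            by_contra hgx
            exact Set.disjoint_left.1 hd hx hgx
          simp [this]
      rw [this]
      linarith
    | isClosed => exact isClosed_le (by fun_prop) (by fun_prop)
  have h1 : R f = f := by
    ext1
    have hf' : ∀ᵐ x ∂μ, x ∉ A → f x = 0 := hf
    filter_upwards [hR f, hf'] with x e1 e2
    rw [e1]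
    by_cases hx : x ∈ A
    · simp [hx]
    · simp [hx, e2 hx]
  have := key f
  rw [h1] at this
  linarith

lemma exists_pos_set (μ : Measure Ω) {A : Set Ω} (hA : MeasurableSet A) (hfin : μ A ≠ ∞)
    (φ : Lp ℝ 1 μ →L[ℝ] ℝ) (c : ℝ) (hc : 0 ≤ c) (f : Lp ℝ 1 μ) (hf : f ∈ LoneSub μ A)
    (hlt : c * ‖f‖ < φ f) :
    ∃ s : ℝ, (s = 1 ∨ s = -1) ∧ ∃ B, B ⊆ A ∧ MeasurableSet B ∧ 0 < μ B ∧
      ∀ C, C ⊆ B → ∀ (hC : MeasurableSet C) (hCf : μ C ≠ ∞),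
        c * μ.real C ≤ s * φ (oneInd μ hC hCf) := by
  obtain ⟨B, hBA, hB, hBf, hlt⟩ := exists_big_set μ hA φ c hc f hf hlt
  obtain ⟨s, hs, hslt⟩ : ∃ s : ℝ, (s = 1 ∨ s = -1) ∧ c * μ.real B < s * φ (oneInd μ hB hBf) := by
    rcases lt_abs.1 hlt with h | h
    · exact ⟨1, Or.inl rfl, by linarith⟩
    · exact ⟨-1, Or.inr rfl, by linarith⟩
  refine ⟨s, hs, ?_⟩
  obtain ⟨I, hI⟩ := exists_intCLM μ (fun _ => 1) measurable_const (by simp)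
  have hI' : ∀ (C : Set Ω) (hC : MeasurableSet C) (hCf : μ C ≠ ∞),
      I (oneInd μ hC hCf) = μ.real C := by
    intro C hC hCf
    rw [hI]
    simp only [one_mul]
    rw [oneInd, integral_congr_ae indicatorConstLp_coeFn, integral_indicator hC]
    simp
  obtain ⟨m, hm⟩ := exists_sm μ hA hfin (c • I - s • φ)
  have hm' : ∀ X, X ⊆ A → ∀ (hX : MeasurableSet X) (hXf : μ X ≠ ∞),
      m X = c * μ.real X - s * φ (oneInd μ hX hXf) := by
    intro X hXA hX hXf
    rw [hm X hXA hX hXf]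
    simp [hI']
  have hneg : m B < 0 := by rw [hm' B hBA hB hBf]; linarith
  obtain ⟨D, hD, hDB, hDm, hDneg⟩ := SignedMeasure.exists_subset_restrict_nonpos hneg
  have hDf : μ D ≠ ∞ := ne_top_of_le_ne_top hBf (measure_mono hDB)
  refine ⟨D, hDB.trans hBA, hD, ?_, ?_⟩
  · rw [pos_iff_ne_zero]
    intro h0
    have e : oneInd μ hD hDf = 0 := by
      rw [← norm_eq_zero, norm_oneInd, measureReal_def, h0]; simp
    rw [hm' D (hDB.trans hBA) hD hDf, e, measureReal_def, h0] at hDneg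
    simp at hDneg
  · intro C hCD hC hCf
    have := (VectorMeasure.restrict_le_restrict_iff _ _ hD).1 hDm hC hCD
    rw [hm' C (hCD.trans (hDB.trans hBA)) hC hCf] at this
    simpa using this

lemma half_main (μ : Measure Ω) {A : Set Ω} (hA : MeasurableSet A) (hfin : μ A ≠ ∞)
    (T : Lp ℝ 1 μ →L[ℝ] Lp ℝ 1 μ) (δ : ℝ) (hδ : 0 < δ) (hδ1 : δ < 1)
    (hD : ‖(LoneSub μ A).subtypeL + T.comp (LoneSub μ A).subtypeL‖
        = 1 + ‖T.comp (LoneSub μ A).subtypeL‖) :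
    ∃ B, B ⊆ A ∧ MeasurableSet B ∧ 0 < μ B ∧
      ∀ C, C ⊆ B → ∀ (hC : MeasurableSet C) (hCf : μ C ≠ ∞),
        ∫ x in C, (|T (oneInd μ hC hCf) x| - T (oneInd μ hC hCf) x) ∂μ ≤ δ * μ.real C := by
  set M := ‖T.comp (LoneSub μ A).subtypeL‖ with hM
  have hM0 : 0 ≤ M := ContinuousLinearMap.opNorm_nonneg _
  obtain ⟨f, hf1, hf2⟩ := ContinuousLinearMap.exists_lt_apply_of_lt_opNorm
    ((LoneSub μ A).subtypeL + T.comp (LoneSub μ A).subtypeL) (r := 1 + M - δ) (by linarith)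
  set u : Lp ℝ 1 μ := (f : Lp ℝ 1 μ) + T f with hu
  have hf2' : 1 + M - δ < ‖u‖ := hf2
  have hum : Measurable u := (Lp.stronglyMeasurable u).measurable
  let σ : Ω → ℝ := fun x => if 0 ≤ u x then 1 else -1
  have hσm : Measurable σ :=
    Measurable.ite (measurableSet_le measurable_const hum) measurable_const measurable_const
  have hσ1 : ∀ x, σ x = 1 ∨ σ x = -1 := by
    intro x
    by_cases h : 0 ≤ u x <;> simp [σ, h]
  have hσb : ∀ x, |σ x| ≤ 1 := by
    intro x
    rcases hσ1 x with h | h <;> simp [h]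
  obtain ⟨L, hL⟩ := exists_intCLM μ σ hσm hσb
  have hLu : L u = ‖u‖ := by
    rw [hL, L1.norm_eq_integral_norm]
    congr 1
    ext x
    by_cases h : 0 ≤ u x
    · simp [σ, h, abs_of_nonneg]
    · simp [σ, h, abs_of_neg (not_le.1 h)]
  have hc : 0 ≤ 1 + M - δ := by linarith
  obtain ⟨s, hs, B, hBA, hB, hBpos, hBC⟩ := exists_pos_set μ hA hfin
    (L + L.comp T) (1 + M - δ) hc (f : Lp ℝ 1 μ) f.2 (by
      have h1 : (L + L.comp T) (f : Lp ℝ 1 μ) = L u := by simp [hu]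
      rw [h1, hLu]
      have h2 : ‖(f : Lp ℝ 1 μ)‖ < 1 := hf1
      nlinarith)
  let τ : Ω → ℝ := fun x => s * σ x
  have hτm : Measurable τ := hσm.const_mul s
  have hτ1 : ∀ x, τ x = 1 ∨ τ x = -1 := by
    intro x
    rcases hs with h | h <;> rcases hσ1 x with h' | h' <;> simp [τ, h, h']
  have hτb : ∀ x, |τ x| ≤ 1 := by
    intro x
    rcases hτ1 x with h | h <;> simp [h]
  have hτi : ∀ h : Lp ℝ 1 μ, Integrable (fun x => τ x * h x) μ := fun h =>
    (L1.integrable_coeFn h).bdd_mul hτm.aestronglyMeasurable (Eventually.of_forall hτb)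
  have hsL : ∀ h, s * L h = ∫ x, τ x * h x ∂μ := by
    intro h
    rw [hL, ← integral_const_mul]
    simp only [τ, mul_assoc]
  have hind : ∀ (C : Set Ω) (hC : MeasurableSet C) (hCf : μ C ≠ ∞),
      s * L (oneInd μ hC hCf) = ∫ x in C, τ x ∂μ := by
    intro C hC hCf
    rw [hsL, ← integral_indicator hC]
    apply integral_congr_ae
    filter_upwards [indicatorConstLp_coeFn (p := 1) (hs := hC) (hμs := hCf) (c := (1 : ℝ))]
      with x hx
    rw [oneInd, hx]
    by_cases h : x ∈ C <;> simp [h]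
  have hBf : μ B ≠ ∞ := ne_top_of_le_ne_top hfin (measure_mono hBA)
  have hTn : ∀ C, C ⊆ A → ∀ (hC : MeasurableSet C) (hCf : μ C ≠ ∞),
      ‖T (oneInd μ hC hCf)‖ ≤ M * μ.real C := by
    intro C hCA hC hCf
    have hmem : oneInd μ hC hCf ∈ LoneSub μ A := by
      change ∀ᵐ x ∂μ, x ∉ A → oneInd μ hC hCf x = 0
      filter_upwards [indicatorConstLp_coeFn_notMem (p := 1) (hs := hC) (hμs := hCf) (c := (1 : ℝ))]
        with x hx hxA
      exact hx fun h => hxA (hCA h)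
    have := (T.comp (LoneSub μ A).subtypeL).le_opNorm ⟨_, hmem⟩
    rw [← norm_oneInd μ hC hCf]
    exact this
  have hTle : ∀ h : Lp ℝ 1 μ, s * L h ≤ ‖h‖ := by
    intro h
    rw [hsL, L1.norm_eq_integral_norm]
    refine integral_mono (hτi h) (L1.integrable_coeFn h).norm ?_
    intro x
    change τ x * h x ≤ |h x|
    rcases hτ1 x with e | e <;> rw [e]
    · rw [one_mul]; exact le_abs_self _
    · rw [neg_one_mul]; exact neg_le_abs _
  have hkey : ∀ C, C ⊆ B → ∀ (hC : MeasurableSet C) (hCf : μ C ≠ ∞),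
      (1 + M - δ) * μ.real C ≤ ∫ x in C, τ x ∂μ + s * L (T (oneInd μ hC hCf)) := by
    intro C hCB hC hCf
    have := hBC C hCB hC hCf
    rw [← hind C hC hCf]
    simpa [mul_add] using this
  -- the set where `τ = -1`
  have hnull : μ (B ∩ {x | τ x = -1}) = 0 := by
    have hC : MeasurableSet (B ∩ {x | τ x = -1}) :=
      hB.inter (hτm (measurableSet_singleton (-1)))
    have hCf : μ (B ∩ {x | τ x = -1}) ≠ ∞ :=
      ne_top_of_le_ne_top hBf (measure_mono Set.inter_subset_left)
    have h1 := hkey _ Set.inter_subset_left hC hCf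
    have h2 := hTle (T (oneInd μ hC hCf))
    have h3 := hTn _ (Set.inter_subset_left.trans hBA) hC hCf
    have h4 : ∫ x in B ∩ {x | τ x = -1}, τ x ∂μ = - μ.real (B ∩ {x | τ x = -1}) := by
      rw [setIntegral_congr_fun hC (g := fun _ => (-1 : ℝ)) (fun x hx => hx.2)]
      simp
    have h5 : 0 ≤ μ.real (B ∩ {x | τ x = -1}) := measureReal_nonneg
    have h6 : μ.real (B ∩ {x | τ x = -1}) = 0 := by nlinarith
    exact (measureReal_eq_zero_iff hCf).1 h6
  have hae : ∀ᵐ x ∂μ, x ∈ B → τ x = 1 := by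
    rw [ae_iff]
    refine measure_mono_null ?_ hnull
    intro x hx
    have hx' : ¬ (x ∈ B → τ x = 1) := hx
    push Not at hx'
    exact ⟨hx'.1, (hτ1 x).resolve_left hx'.2⟩
  refine ⟨B, hBA, hB, hBpos, ?_⟩
  intro C hCB hC hCf
  set h := T (oneInd μ hC hCf) with hh
  have h1 := hkey C hCB hC hCf
  have h2 : ∫ x in C, τ x ∂μ = μ.real C := by
    rw [setIntegral_congr_ae hC (g := fun _ => (1 : ℝ))
      (by filter_upwards [hae] with x hx hxC using hx (hCB hxC))]
    simp
  have h3 := hTn C (hCB.trans hBA) hC hCf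
  rw [h2] at h1
  have hi : Integrable (fun x => |h x| - τ x * h x) μ :=
    (L1.integrable_coeFn h).abs.sub (hτi h)
  have h4 : ∫ x in C, (|h x| - h x) ∂μ = ∫ x in C, (|h x| - τ x * h x) ∂μ := by
    refine setIntegral_congr_ae hC ?_
    filter_upwards [hae] with x hx hxC
    rw [hx (hCB hxC), one_mul]
  have h5 : ∫ x in C, (|h x| - τ x * h x) ∂μ ≤ ∫ x, (|h x| - τ x * h x) ∂μ := by
    refine setIntegral_le_integral hi (Eventually.of_forall ?_)
    intro x
    change 0 ≤ |h x| - τ x * h x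
    rcases hτ1 x with e | e <;> rw [e]
    · have := le_abs_self (h x); linarith
    · have := neg_le_abs (h x); linarith
  have h6 : ∫ x, (|h x| - τ x * h x) ∂μ = ‖h‖ - s * L h := by
    rw [integral_sub (L1.integrable_coeFn h).abs (hτi h), hsL, L1.norm_eq_integral_norm]
    rfl
  rw [h4]
  linarith

/-- Any linear space of operators all of whose restrictions satisfy the
Daugavet equation is contained in `M`. -/
theorem stmt8 (μ : Measure Ω) (hsemi : ∀ A : Set Ω, MeasurableSet A → μ A = ∞ →
      ∃ B ⊆ A, MeasurableSet B ∧ 0 < μ B ∧ μ B < ∞)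
    (N : Set (Lp ℝ 1 μ →L[ℝ] Lp ℝ 1 μ)) (h0 : (0 : Lp ℝ 1 μ →L[ℝ] Lp ℝ 1 μ) ∈ N)
    (hadd : ∀ U ∈ N, ∀ V ∈ N, U + V ∈ N)
    (hsmul : ∀ (c : ℝ), ∀ T ∈ N, c • T ∈ N)
    (hDaug : ∀ T ∈ N, ∀ A : Set Ω, MeasurableSet A → 0 < μ A →
      ‖(LoneSub μ A).subtypeL + T.comp (LoneSub μ A).subtypeL‖
        = 1 + ‖T.comp (LoneSub μ A).subtypeL‖) :
    ∀ T ∈ N, ∀ ε > (0 : ℝ), ∀ A : Set Ω, MeasurableSet A → 0 < μ A →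
      ∃ B ⊆ A, ∃ (hBm : MeasurableSet B) (hBfin : μ B ≠ ∞), 0 < μ B ∧
        ∫ x in B, |(T (normInd μ hBm hBfin) : Ω → ℝ) x| ∂μ < ε := by
  intro T hT ε hε A hA hApos
  obtain ⟨A', hA'A, hA', hA'pos, hA'f⟩ :
      ∃ A' ⊆ A, MeasurableSet A' ∧ 0 < μ A' ∧ μ A' < ∞ := by
    by_cases h : μ A = ∞
    · exact hsemi A hA h
    · exact ⟨A, subset_rfl, hA, hApos, lt_top_iff_ne_top.2 h⟩
  have hδ : 0 < min (ε / 2) (1 / 2) := by positivity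
  have hδ1 : min (ε / 2) (1 / 2) < (1 : ℝ) := (min_le_right _ _).trans_lt (by norm_num)
  have hδ2 : min (ε / 2) (1 / 2) ≤ ε / 2 := min_le_left _ _
  set δ := min (ε / 2) (1 / 2)
  obtain ⟨B, hBA, hB, hBpos, hBC⟩ := half_main μ hA' hA'f.ne T δ hδ hδ1 (hDaug T hT A' hA' hA'pos)
  have hBf : μ B ≠ ∞ := ne_top_of_le_ne_top hA'f.ne (measure_mono hBA)
  obtain ⟨C, hCB, hC, hCpos, hCC⟩ := half_main μ hB hBf ((-1 : ℝ) • T) δ hδ hδ1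
    (hDaug _ (hsmul (-1) T hT) B hB hBpos)
  have hCf : μ C ≠ ∞ := ne_top_of_le_ne_top hBf (measure_mono hCB)
  refine ⟨C, hCB.trans (hBA.trans hA'A), hC, hCf, hCpos, ?_⟩
  have h1 := hBC C hCB hC hCf
  have h2 := hCC C subset_rfl hC hCf
  set h := T (oneInd μ hC hCf) with hh
  have hi : Integrable h (μ.restrict C) := (L1.integrable_coeFn h).restrict
  have h3 : ∫ x in C, (|((-1 : ℝ) • T) (oneInd μ hC hCf) x| - ((-1 : ℝ) • T) (oneInd μ hC hCf) x) ∂μ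
      = ∫ x in C, (|h x| + h x) ∂μ := by
    apply setIntegral_congr_ae hC
    filter_upwards [Lp.coeFn_smul (-1 : ℝ) h] with x hx _
    change |((-1 : ℝ) • h : Lp ℝ 1 μ) x| - ((-1 : ℝ) • h : Lp ℝ 1 μ) x = _
    rw [hx]
    simp
  rw [h3, integral_add hi.abs hi] at h2
  rw [integral_sub hi.abs hi] at h1
  have hr : 0 < μ.real C := ENNReal.toReal_pos hCpos.ne' hCf
  have h4 : ∫ x in C, |T (normInd μ hC hCf) x| ∂μ = (μ.real C)⁻¹ * ∫ x in C, |h x| ∂μ := by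
    rw [← integral_const_mul]
    apply setIntegral_congr_ae hC
    have e : T (normInd μ hC hCf) = (μ.real C)⁻¹ • h := by
      rw [normInd, oneInd_smul, map_smul]; rfl
    rw [e]
    filter_upwards [Lp.coeFn_smul (μ.real C)⁻¹ h] with x hx _
    rw [hx, Pi.smul_apply, smul_eq_mul, abs_mul, abs_of_pos (inv_pos.2 hr)]
  rw [h4, inv_mul_lt_iff₀ hr]
  nlinarith
end
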